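/- Let S be a set of n ≥ 2 points in ℝ^d with ‖x‖_2 ≤ 1 for all x ∈ S, and let m ≥ 1 be an integer. Then there exist an integer k ≤ 512 m⁴ log n + 1 and a matrix R ∈ ℝ^{k×d} each of whose entries equals +1/√k or −1/√k, such that for all x, y ∈ S, |(Rx)ᵀ(Ry) − xᵀy| ≤ 1/(8m²). -/

import Mathlib

open Matrix
open scoped BigOperators

lemma expect_fin_cons {Ω : Type*} [Fintype Ω] (n : ℕ) (f : (Fin (n + 1) → Ω) → ℝ) :
    𝔼 w, f w = 𝔼 a, 𝔼 t, f (Fin.cons a t) := by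
  rw [← Fintype.expect_equiv (Fin.consEquiv fun _ => Ω) (fun p => f (Fin.cons p.1 p.2)) f
    (fun p => rfl)]
  rw [← Finset.univ_product_univ, Finset.expect_product]

lemma expect_bool (f : Bool → ℝ) : 𝔼 b, f b = (f true + f false) / 2 := by
  rw [Fintype.expect_eq_sum_div_card]; simp

lemma expect_mono {Ω : Type*} [Fintype Ω] {f g : Ω → ℝ} (h : ∀ w, f w ≤ g w) :
    𝔼 w, f w ≤ 𝔼 w, g w := Finset.expect_le_expect (fun w _ => h w)

/-- The Rademacher sum `∑ ± x j` with signs given by `s`. -/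
def rademacherSum {d : ℕ} (x : Fin d → ℝ) (s : Fin d → Bool) : ℝ :=
  ∑ j, (if s j then 1 else -1) * x j

lemma rademacherSum_cons {d : ℕ} (x : Fin (d + 1) → ℝ) (b : Bool) (t : Fin d → Bool) :
    rademacherSum x (Fin.cons b t) =
      (if b then 1 else -1) * x 0 + rademacherSum (fun i => x i.succ) t := by
  simp [rademacherSum, Fin.sum_univ_succ]

lemma rademacherSum_add {d : ℕ} (x y : Fin d → ℝ) (s : Fin d → Bool) :
    rademacherSum (x + y) s = rademacherSum x s + rademacherSum y s := by
  simp [rademacherSum, mul_add, Finset.sum_add_distrib]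

lemma rademacherSum_sub {d : ℕ} (x y : Fin d → ℝ) (s : Fin d → Bool) :
    rademacherSum (x - y) s = rademacherSum x s - rademacherSum y s := by
  simp [rademacherSum, mul_sub, Finset.sum_sub_distrib]

lemma rademacherSum_neg {d : ℕ} (x : Fin d → ℝ) (s : Fin d → Bool) :
    rademacherSum (-x) s = -rademacherSum x s := by
  simp [rademacherSum]

lemma rademacherSum_smul {d : ℕ} (a : ℝ) (x : Fin d → ℝ) (s : Fin d → Bool) :
    rademacherSum (a • x) s = a * rademacherSum x s := by
  simp [rademacherSum, Finset.mul_sum, mul_left_comm]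

lemma rademacherSum_zero {d : ℕ} (s : Fin d → Bool) :
    rademacherSum (0 : Fin d → ℝ) s = 0 := by
  simp [rademacherSum]

lemma dotProduct_succ {d : ℕ} (x y : Fin (d + 1) → ℝ) :
    x ⬝ᵥ y = x 0 * y 0 + (fun i => x (Fin.succ i)) ⬝ᵥ (fun i => y (Fin.succ i)) := by
  simp [dotProduct, Fin.sum_univ_succ]

lemma expect_rademacherSum_mul {d : ℕ} (x y : Fin d → ℝ) :
    𝔼 s, rademacherSum x s * rademacherSum y s = x ⬝ᵥ y := by
  induction d with
  | zero => simp [rademacherSum]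
  | succ d ih =>
    rw [expect_fin_cons, expect_bool, dotProduct_succ, ← ih, ← Finset.expect_add_distrib,
      Finset.expect_div]
    have h : ∀ t : Fin d → Bool,
        (rademacherSum x (Fin.cons true t) * rademacherSum y (Fin.cons true t) +
          rademacherSum x (Fin.cons false t) * rademacherSum y (Fin.cons false t)) / 2 =
        x 0 * y 0 + rademacherSum (fun i => x i.succ) t * rademacherSum (fun i => y i.succ) t := by
      intro t
      simp only [rademacherSum_cons]
      simp
      ring
    simp only [h]
    rw [Finset.expect_add_distrib, Fintype.expect_const]

lemma expect_rademacherSum_mul_four {d : ℕ} (x y z w : Fin d → ℝ) :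
    𝔼 s, rademacherSum x s * rademacherSum y s * (rademacherSum z s * rademacherSum w s) =
      (x ⬝ᵥ y) * (z ⬝ᵥ w) + (x ⬝ᵥ z) * (y ⬝ᵥ w) + (x ⬝ᵥ w) * (y ⬝ᵥ z)
        - 2 * ∑ i, x i * y i * z i * w i := by
  induction d with
  | zero => simp [rademacherSum]
  | succ d ih =>
    rw [expect_fin_cons, expect_bool, ← Finset.expect_add_distrib, Finset.expect_div]
    set x' := fun i : Fin d => x i.succ with hx
    set y' := fun i : Fin d => y i.succ with hy
    set z' := fun i : Fin d => z i.succ with hz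
    set w' := fun i : Fin d => w i.succ with hw
    have h : ∀ t : Fin d → Bool,
        (rademacherSum x (Fin.cons true t) * rademacherSum y (Fin.cons true t) *
            (rademacherSum z (Fin.cons true t) * rademacherSum w (Fin.cons true t)) +
          rademacherSum x (Fin.cons false t) * rademacherSum y (Fin.cons false t) *
            (rademacherSum z (Fin.cons false t) * rademacherSum w (Fin.cons false t))) / 2 =
        x 0 * y 0 * z 0 * w 0 + (x 0 * y 0) * (rademacherSum z' t * rademacherSum w' t)
          + (x 0 * z 0) * (rademacherSum y' t * rademacherSum w' t)
          + (x 0 * w 0) * (rademacherSum y' t * rademacherSum z' t)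
          + (y 0 * z 0) * (rademacherSum x' t * rademacherSum w' t)
          + (y 0 * w 0) * (rademacherSum x' t * rademacherSum z' t)
          + (z 0 * w 0) * (rademacherSum x' t * rademacherSum y' t)
          + rademacherSum x' t * rademacherSum y' t *
            (rademacherSum z' t * rademacherSum w' t) := by
      intro t
      simp only [rademacherSum_cons]
      simp only [if_true, Bool.false_eq_true, if_false]
      ring
    simp only [h, Finset.expect_add_distrib, ← Finset.mul_expect, ih, expect_rademacherSum_mul,
      Fintype.expect_const]
    rw [dotProduct_succ x y, dotProduct_succ z w, dotProduct_succ x z, dotProduct_succ y w,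
      dotProduct_succ x w, dotProduct_succ y z, Fin.sum_univ_succ]
    ring

lemma sum_range_two_mul_add_one (f : ℕ → ℝ) (j : ℕ) :
    ∑ i ∈ Finset.range (2 * j + 1), f i =
      ∑ l ∈ Finset.range (j + 1), f (2 * l) + ∑ l ∈ Finset.range j, f (2 * l + 1) := by
  induction j with
  | zero => simp
  | succ j ih =>
    rw [show 2 * (j + 1) + 1 = 2 * j + 1 + 1 + 1 by ring, Finset.sum_range_succ,
      Finset.sum_range_succ, ih, Finset.sum_range_succ _ (j + 1),
      Finset.sum_range_succ (fun l => f (2 * l + 1)) j]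
    rw [show 2 * (j + 1) = 2 * j + 1 + 1 by ring]
    ring

lemma even_part_add_pow (a b : ℝ) (j : ℕ) :
    ((a + b) ^ (2 * j) + (-a + b) ^ (2 * j)) / 2 =
      ∑ l ∈ Finset.range (j + 1), a ^ (2 * l) * b ^ (2 * (j - l)) * ((2 * j).choose (2 * l)) := by
  rw [add_pow, add_pow, ← Finset.sum_add_distrib, sum_range_two_mul_add_one]
  have h1 : ∀ l, a ^ (2 * l + 1) * b ^ (2 * j - (2 * l + 1)) * ((2 * j).choose (2 * l + 1) : ℝ) +
      (-a) ^ (2 * l + 1) * b ^ (2 * j - (2 * l + 1)) * ((2 * j).choose (2 * l + 1)) = 0 := by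
    intro l
    rw [Odd.neg_pow ⟨l, rfl⟩]
    ring
  rw [Finset.sum_congr rfl (fun l _ => h1 l), Finset.sum_const_zero, add_zero, Finset.sum_div]
  refine Finset.sum_congr rfl fun l _ => ?_
  rw [Even.neg_pow (even_two_mul l), show 2 * j - 2 * l = 2 * (j - l) by omega]
  ring

lemma choose_two_mul_mul_le {j l : ℕ} (h : l ≤ j) :
    ((2 * j).choose (2 * l) : ℝ) * ((2 * (j - l)).factorial / (2 ^ (j - l) * (j - l).factorial)) ≤
      (2 * j).factorial / (2 ^ j * j.factorial) * (j.choose l) := by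
  have h2 : 2 * l ≤ 2 * j := by omega
  rw [Nat.cast_choose ℝ h2, Nat.cast_choose ℝ h, show 2 * j - 2 * l = 2 * (j - l) by omega]
  have hf : ∀ n : ℕ, (0 : ℝ) < n.factorial := fun n => by exact_mod_cast n.factorial_pos
  have hl : (2 ^ l * l.factorial : ℝ) ≤ (2 * l).factorial := by
    exact_mod_cast Nat.two_pow_mul_factorial_le_factorial_two_mul l
  have hp : (2 : ℝ) ^ j = 2 ^ l * 2 ^ (j - l) := by rw [← pow_add]; congr 1; omega
  have e1 : ((2 * j).factorial : ℝ) / ((2 * l).factorial * (2 * (j - l)).factorial) *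
      ((2 * (j - l)).factorial / (2 ^ (j - l) * (j - l).factorial)) =
      (2 * j).factorial / (2 ^ (j - l) * (j - l).factorial) / (2 * l).factorial := by
    have := hf (2 * (j - l)); have := hf (j - l); have := hf (2 * l)
    field_simp
  have e2 : ((2 * j).factorial : ℝ) / (2 ^ j * j.factorial) *
      (j.factorial / (l.factorial * (j - l).factorial)) =
      (2 * j).factorial / (2 ^ (j - l) * (j - l).factorial) / (2 ^ l * l.factorial) := by
    have := hf j; have := hf (j - l); have := hf l
    rw [hp]
    field_simp
  rw [e1, e2]
  have := hf l
  have := hf (2 * j)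
  have := hf (j - l)
  gcongr

/-- Even moments of a Rademacher sum are at most the Gaussian ones. -/
lemma expect_rademacherSum_pow_le {d : ℕ} (x : Fin d → ℝ) (j : ℕ) :
    𝔼 s, rademacherSum x s ^ (2 * j) ≤
      (2 * j).factorial / (2 ^ j * j.factorial) * (x ⬝ᵥ x) ^ j := by
  induction d generalizing j with
  | zero =>
    rcases j with _ | j
    · simp
    · simp [rademacherSum, mul_add]
  | succ d ih =>
    rw [expect_fin_cons, expect_bool, dotProduct_succ, ← Finset.expect_add_distrib,
      Finset.expect_div]
    simp only [rademacherSum_cons, if_true, Bool.false_eq_true, if_false, one_mul, neg_mul,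
      even_part_add_pow]
    rw [Finset.expect_sum_comm, add_pow, Finset.mul_sum]
    refine Finset.sum_le_sum fun l hl => ?_
    have hlj : l ≤ j := Nat.lt_succ_iff.mp (Finset.mem_range.mp hl)
    rw [← Finset.expect_mul, ← Finset.mul_expect]
    have hd : 0 ≤ (fun i => x (Fin.succ i)) ⬝ᵥ (fun i => x (Fin.succ i)) := by
      simp only [dotProduct]
      exact Finset.sum_nonneg fun i _ => mul_self_nonneg _
    set D := (fun i => x (Fin.succ i)) ⬝ᵥ (fun i => x (Fin.succ i))
    have hx : (x 0 * x 0) ^ l = x 0 ^ (2 * l) := by rw [pow_mul]; ring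
    have h0 : 0 ≤ x 0 ^ (2 * l) := (even_two_mul l).pow_nonneg _
    rw [hx]
    calc _ ≤ x 0 ^ (2 * l) * ((2 * (j - l)).factorial / (2 ^ (j - l) * (j - l).factorial) *
            D ^ (j - l)) * ((2 * j).choose (2 * l)) := by
          gcongr
          exact ih _ (j - l)
      _ = x 0 ^ (2 * l) * D ^ (j - l) * (((2 * j).choose (2 * l) : ℝ) *
            ((2 * (j - l)).factorial / (2 ^ (j - l) * (j - l).factorial))) := by ring
      _ ≤ x 0 ^ (2 * l) * D ^ (j - l) *
            ((2 * j).factorial / (2 ^ j * j.factorial) * (j.choose l)) := by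
          exact mul_le_mul_of_nonneg_left (choose_two_mul_mul_le hlj) (by positivity)
      _ = _ := by ring

lemma exp_remainder_mono {z p : ℝ} (h : z ≤ p) :
    Real.exp z - 1 - z - z ^ 2 / 2 ≤ Real.exp p - 1 - p - p ^ 2 / 2 := by
  have hm : Monotone fun t : ℝ => Real.exp t - 1 - t - t ^ 2 / 2 := by
    have hd : ∀ t : ℝ, HasDerivAt (fun t : ℝ => Real.exp t - 1 - t - t ^ 2 / 2)
        (Real.exp t - 1 - t) t := by
      intro t
      have := (((Real.hasDerivAt_exp t).sub_const 1).sub (hasDerivAt_id t)).sub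
        ((hasDerivAt_pow 2 t).div_const 2)
      refine this.congr_deriv ?_
      simp
    refine monotone_of_deriv_nonneg (fun t => (hd t).differentiableAt) fun t => ?_
    rw [(hd t).deriv]
    linarith [Real.add_one_le_exp t]
  exact hm h

lemma centralBinom_add_three_le (n : ℕ) : Nat.centralBinom (n + 3) ≤ 20 * 4 ^ n := by
  induction n with
  | zero => decide
  | succ n ih =>
    have h := Nat.succ_mul_centralBinom_succ (n + 3)
    have : (n + 4) * Nat.centralBinom (n + 4) ≤ (n + 4) * (20 * 4 ^ (n + 1)) := by
      rw [h, pow_succ]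
      nlinarith [Nat.zero_le (4 ^ n)]
    exact Nat.le_of_mul_le_mul_left this (by omega)

lemma gaussian_moment_div_factorial_le (n : ℕ) :
    ((2 * (n + 3)).factorial : ℝ) / (2 ^ (n + 3) * (n + 3).factorial) / (n + 3).factorial ≤
      5 / 2 * 2 ^ n := by
  have h1 : ((2 * (n + 3)).factorial : ℝ) =
      Nat.centralBinom (n + 3) * (n + 3).factorial * (n + 3).factorial := by
    have := Nat.choose_mul_factorial_mul_factorial (show n + 3 ≤ 2 * (n + 3) by omega)
    rw [show 2 * (n + 3) - (n + 3) = n + 3 by omega] at this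
    rw [Nat.centralBinom]
    exact_mod_cast this.symm
  have h2 : (Nat.centralBinom (n + 3) : ℝ) ≤ 20 * 4 ^ n := by
    exact_mod_cast centralBinom_add_three_le n
  have hf : (0 : ℝ) < (n + 3).factorial := by exact_mod_cast (n + 3).factorial_pos
  rw [h1, div_div, div_le_iff₀ (by positivity)]
  have h4 : (4 : ℝ) ^ n = 2 ^ n * 2 ^ n := by rw [← mul_pow]; norm_num
  calc _ ≤ 20 * 4 ^ n * ((n + 3).factorial : ℝ) * (n + 3).factorial := by gcongr
    _ = _ := by rw [h4, pow_add]; ring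

lemma hasSum_exp_remainder (x : ℝ) :
    HasSum (fun n : ℕ => x ^ (n + 3) / (n + 3).factorial) (Real.exp x - 1 - x - x ^ 2 / 2) := by
  have h := NormedSpace.expSeries_div_hasSum_exp (𝔸 := ℝ) x
  rw [← Real.exp_eq_exp_ℝ] at h
  have h3 := (hasSum_nat_add_iff' 3).mpr h
  have he : Real.exp x - ∑ i ∈ Finset.range 3, x ^ i / i.factorial =
      Real.exp x - 1 - x - x ^ 2 / 2 := by
    simp [Finset.sum_range_succ]
    ring
  rwa [he] at h3

lemma hasSum_expect {Ω : Type*} [Fintype Ω] {f : ℕ → Ω → ℝ} {g : Ω → ℝ}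
    (h : ∀ w, HasSum (fun n => f n w) (g w)) :
    HasSum (fun n => 𝔼 w, f n w) (𝔼 w, g w) := by
  simp only [Fintype.expect_eq_sum_div_card]
  exact (hasSum_sum fun w _ => h w).div_const _

lemma expect_mul_rademacherSum_sq_pow_le {d : ℕ} (u : Fin d → ℝ) {α : ℝ} (hα : 0 ≤ α) (j : ℕ) :
    𝔼 s, (α * rademacherSum u s ^ 2) ^ j ≤
      (2 * j).factorial / (2 ^ j * j.factorial) * (α * (u ⬝ᵥ u)) ^ j := by
  have h : ∀ s, (α * rademacherSum u s ^ 2) ^ j = α ^ j * rademacherSum u s ^ (2 * j) := by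
    intro s; rw [mul_pow, pow_mul]
  simp only [h]
  rw [← Finset.mul_expect, mul_pow]
  calc _ ≤ α ^ j * ((2 * j).factorial / (2 ^ j * j.factorial) * (u ⬝ᵥ u) ^ j) := by
        gcongr
        exact expect_rademacherSum_pow_le u j
    _ = _ := by ring

lemma expect_exp_remainder_le {d : ℕ} (u : Fin d → ℝ) {α : ℝ} (hα : 0 ≤ α)
    (hs : 2 * (α * (u ⬝ᵥ u)) < 1) (h0 : 0 ≤ u ⬝ᵥ u) :
    𝔼 s, (Real.exp (α * rademacherSum u s ^ 2) - 1 - α * rademacherSum u s ^ 2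
      - (α * rademacherSum u s ^ 2) ^ 2 / 2) ≤
      5 / 2 * (α * (u ⬝ᵥ u)) ^ 3 / (1 - 2 * (α * (u ⬝ᵥ u))) := by
  set a := α * (u ⬝ᵥ u) with ha
  have ha0 : 0 ≤ a := mul_nonneg hα h0
  have hg := (hasSum_geometric_of_lt_one (by positivity : 0 ≤ 2 * a) hs).mul_left (5 / 2 * a ^ 3)
  have hE := hasSum_expect (fun s : Fin d → Bool =>
    hasSum_exp_remainder (α * rademacherSum u s ^ 2))
  rw [div_eq_mul_inv]
  refine hasSum_le (fun n => ?_) hE hg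
  rw [← Finset.expect_div]
  have hf : (0 : ℝ) < (n + 3).factorial := by exact_mod_cast (n + 3).factorial_pos
  calc _ ≤ ((2 * (n + 3)).factorial / (2 ^ (n + 3) * (n + 3).factorial) * a ^ (n + 3)) /
          (n + 3).factorial := by
        gcongr
        exact expect_mul_rademacherSum_sq_pow_le u hα (n + 3)
    _ = ((2 * (n + 3)).factorial : ℝ) / (2 ^ (n + 3) * (n + 3).factorial) / (n + 3).factorial *
          a ^ (n + 3) := by ring
    _ ≤ 5 / 2 * 2 ^ n * a ^ (n + 3) := by
        gcongr
        exact gaussian_moment_div_factorial_le n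
    _ = _ := by ring

/-- The centred quadratic form `α (⟨s,u⟩² - ‖u‖²) - β (⟨s,v⟩² - ‖v‖²)` in a sign vector `s`. -/
def signForm {d : ℕ} (α β : ℝ) (u v : Fin d → ℝ) (s : Fin d → Bool) : ℝ :=
  α * rademacherSum u s ^ 2 - β * rademacherSum v s ^ 2 - (α * (u ⬝ᵥ u) - β * (v ⬝ᵥ v))

lemma expect_rademacherSum_sq {d : ℕ} (u : Fin d → ℝ) :
    𝔼 s, rademacherSum u s ^ 2 = u ⬝ᵥ u := by
  simp only [sq, expect_rademacherSum_mul]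

lemma expect_quadratic {d : ℕ} (α β : ℝ) (u v : Fin d → ℝ) :
    𝔼 s, (α * rademacherSum u s ^ 2 - β * rademacherSum v s ^ 2) =
      α * (u ⬝ᵥ u) - β * (v ⬝ᵥ v) := by
  rw [Finset.expect_sub_distrib, ← Finset.mul_expect, ← Finset.mul_expect,
    expect_rademacherSum_sq, expect_rademacherSum_sq]

lemma expect_signForm {d : ℕ} (α β : ℝ) (u v : Fin d → ℝ) : 𝔼 s, signForm α β u v s = 0 := by
  simp only [signForm]
  rw [Finset.expect_sub_distrib, expect_quadratic, Fintype.expect_const, sub_self]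

lemma expect_quadratic_sq_le {d : ℕ} (α β : ℝ) (u v : Fin d → ℝ) (huv : u ⬝ᵥ v = 0) :
    𝔼 s, (α * rademacherSum u s ^ 2 - β * rademacherSum v s ^ 2) ^ 2 ≤
      (α * (u ⬝ᵥ u) - β * (v ⬝ᵥ v)) ^ 2 +
        2 * ((α * (u ⬝ᵥ u)) ^ 2 + (β * (v ⬝ᵥ v)) ^ 2) := by
  have h : ∀ s, (α * rademacherSum u s ^ 2 - β * rademacherSum v s ^ 2) ^ 2 =
      α ^ 2 * (rademacherSum u s * rademacherSum u s * (rademacherSum u s * rademacherSum u s))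
      - 2 * α * β * (rademacherSum u s * rademacherSum u s *
        (rademacherSum v s * rademacherSum v s))
      + β ^ 2 * (rademacherSum v s * rademacherSum v s *
        (rademacherSum v s * rademacherSum v s)) := by
    intro s; ring
  simp only [h, Finset.expect_add_distrib, Finset.expect_sub_distrib, ← Finset.mul_expect,
    expect_rademacherSum_mul_four, huv]
  have hs : 0 ≤ α ^ 2 * ∑ i, u i * u i * u i * u i - 2 * α * β * ∑ i, u i * u i * v i * v i +
      β ^ 2 * ∑ i, v i * v i * v i * v i := by
    simp only [Finset.mul_sum, ← Finset.sum_add_distrib, ← Finset.sum_sub_distrib]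
    refine Finset.sum_nonneg fun i _ => ?_
    nlinarith [sq_nonneg (α * u i ^ 2 - β * v i ^ 2)]
  nlinarith [hs]

lemma expect_signForm_sq_le {d : ℕ} (α β : ℝ) (u v : Fin d → ℝ) (huv : u ⬝ᵥ v = 0) :
    𝔼 s, signForm α β u v s ^ 2 ≤ 2 * ((α * (u ⬝ᵥ u)) ^ 2 + (β * (v ⬝ᵥ v)) ^ 2) := by
  have h := expect_quadratic_sq_le α β u v huv
  have h2 := expect_quadratic α β u v
  set c := α * (u ⬝ᵥ u) - β * (v ⬝ᵥ v) with hc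
  have h3 : ∀ s, signForm α β u v s ^ 2 =
      (α * rademacherSum u s ^ 2 - β * rademacherSum v s ^ 2) ^ 2 -
      2 * c * (α * rademacherSum u s ^ 2 - β * rademacherSum v s ^ 2) + c ^ 2 := by
    intro s; rw [signForm]; ring
  simp only [h3]
  rw [Finset.expect_add_distrib, Finset.expect_sub_distrib, ← Finset.mul_expect, h2,
    Fintype.expect_const]
  linarith

lemma expect_mul_sq_le {Ω : Type*} [Fintype Ω] (f g : Ω → ℝ) :
    (𝔼 w, f w * g w) ^ 2 ≤ (𝔼 w, f w ^ 2) * 𝔼 w, g w ^ 2 := by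
  simp only [Fintype.expect_eq_sum_div_card]
  rw [div_pow, div_mul_div_comm, ← sq]
  gcongr
  exact Finset.sum_mul_sq_le_sq_mul_sq _ _ _

lemma expect_add_pow {Ω Ω' : Type*} [Fintype Ω] [Fintype Ω'] (f : Ω → ℝ) (g : Ω' → ℝ) (n : ℕ) :
    𝔼 a, 𝔼 t, (f a + g t) ^ n =
      ∑ i ∈ Finset.range (n + 1), (n.choose i : ℝ) * (𝔼 a, f a ^ i) * 𝔼 t, g t ^ (n - i) := by
  simp only [add_pow, Finset.expect_sum_comm]
  refine Finset.sum_congr rfl fun i _ => ?_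
  simp only [← Finset.expect_mul, ← Finset.mul_expect]
  ring

section IndependentSums

variable {Ω : Type*} [Fintype Ω] (W : Ω → ℝ)

/-- The sum of `W` over the coordinates of a point of `Ω ^ k`. -/
def rowSum {Ω : Type*} (W : Ω → ℝ) {k : ℕ} (w : Fin k → Ω) : ℝ := ∑ i, W (w i)

lemma expect_rowSum_pow_succ (k n : ℕ) :
    𝔼 w : Fin (k + 1) → Ω, rowSum W w ^ n =
      ∑ i ∈ Finset.range (n + 1), (n.choose i : ℝ) * (𝔼 a, W a ^ i) *
        𝔼 w : Fin k → Ω, rowSum W w ^ (n - i) := by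
  rw [expect_fin_cons, ← expect_add_pow]
  simp [rowSum, Fin.sum_univ_succ]

lemma expect_exp_rowSum (h : ℝ) (k : ℕ) :
    𝔼 w : Fin k → Ω, Real.exp (h * rowSum W w) = (𝔼 a, Real.exp (h * W a)) ^ k := by
  induction k with
  | zero => simp [rowSum]
  | succ k ih =>
    rw [expect_fin_cons, pow_succ, ← ih, mul_comm, Finset.expect_mul_expect]
    simp [rowSum, Fin.sum_univ_succ, mul_add, Real.exp_add]

variable {W} [Nonempty Ω] (h0 : 𝔼 a, W a = 0)

include h0

lemma expect_rowSum (k : ℕ) : 𝔼 w : Fin k → Ω, rowSum W w ^ 1 = 0 := by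
  induction k with
  | zero => simp [rowSum]
  | succ k ih =>
    rw [expect_rowSum_pow_succ]
    simp [Finset.sum_range_succ, h0] at ih ⊢
    exact ih

lemma expect_rowSum_sq (k : ℕ) :
    𝔼 w : Fin k → Ω, rowSum W w ^ 2 = k * 𝔼 a, W a ^ 2 := by
  induction k with
  | zero => simp [rowSum]
  | succ k ih =>
    rw [expect_rowSum_pow_succ]
    simp [Finset.sum_range_succ, h0, ih]
    ring

lemma expect_rowSum_pow_three (k : ℕ) :
    𝔼 w : Fin k → Ω, rowSum W w ^ 3 = k * 𝔼 a, W a ^ 3 := by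
  induction k with
  | zero => simp [rowSum]
  | succ k ih =>
    rw [expect_rowSum_pow_succ]
    have h1 := expect_rowSum h0 k
    simp only [pow_one] at h1
    simp [Finset.sum_range_succ, h0, ih, h1]
    ring

lemma expect_rowSum_pow_four (k : ℕ) :
    𝔼 w : Fin k → Ω, rowSum W w ^ 4 =
      k * (𝔼 a, W a ^ 4) + 3 * k * (k - 1) * (𝔼 a, W a ^ 2) ^ 2 := by
  induction k with
  | zero => simp [rowSum]
  | succ k ih =>
    rw [expect_rowSum_pow_succ]
    have h1 := expect_rowSum h0 k
    simp only [pow_one] at h1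
    simp [Finset.sum_range_succ, Nat.choose, h0, ih, h1, expect_rowSum_sq h0]
    ring

lemma expect_rowSum_pow_five (k : ℕ) :
    𝔼 w : Fin k → Ω, rowSum W w ^ 5 =
      k * (𝔼 a, W a ^ 5) + 10 * k * (k - 1) * (𝔼 a, W a ^ 2) * 𝔼 a, W a ^ 3 := by
  induction k with
  | zero => simp [rowSum]
  | succ k ih =>
    rw [expect_rowSum_pow_succ]
    have h1 := expect_rowSum h0 k
    simp only [pow_one] at h1
    simp [Finset.sum_range_succ, Nat.choose, h0, ih, h1, expect_rowSum_sq h0,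
      expect_rowSum_pow_three h0]
    ring

lemma expect_rowSum_pow_six (k : ℕ) :
    𝔼 w : Fin k → Ω, rowSum W w ^ 6 =
      k * (𝔼 a, W a ^ 6) + 15 * k * (k - 1) * (𝔼 a, W a ^ 2) * (𝔼 a, W a ^ 4) +
        10 * k * (k - 1) * (𝔼 a, W a ^ 3) ^ 2 +
        15 * k * (k - 1) * (k - 2) * (𝔼 a, W a ^ 2) ^ 3 := by
  induction k with
  | zero => simp [rowSum]
  | succ k ih =>
    rw [expect_rowSum_pow_succ]
    have h1 := expect_rowSum h0 k
    simp only [pow_one] at h1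
    simp [Finset.sum_range_succ, Nat.choose, h0, ih, h1, expect_rowSum_sq h0,
      expect_rowSum_pow_three h0, expect_rowSum_pow_four h0]
    ring

lemma expect_rowSum_pow_eight (k : ℕ) :
    𝔼 w : Fin k → Ω, rowSum W w ^ 8 =
      k * (𝔼 a, W a ^ 8) + k * (k - 1) * (28 * (𝔼 a, W a ^ 2) * (𝔼 a, W a ^ 6) +
        56 * (𝔼 a, W a ^ 3) * (𝔼 a, W a ^ 5) + 35 * (𝔼 a, W a ^ 4) ^ 2) +
        k * (k - 1) * (k - 2) * (210 * (𝔼 a, W a ^ 2) ^ 2 * (𝔼 a, W a ^ 4) +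
          280 * (𝔼 a, W a ^ 2) * (𝔼 a, W a ^ 3) ^ 2) +
        105 * k * (k - 1) * (k - 2) * (k - 3) * (𝔼 a, W a ^ 2) ^ 4 := by
  induction k with
  | zero => simp [rowSum]
  | succ k ih =>
    rw [expect_rowSum_pow_succ]
    have h1 := expect_rowSum h0 k
    simp only [pow_one] at h1
    simp [Finset.sum_range_succ, Nat.choose, h0, ih, h1, expect_rowSum_sq h0,
      expect_rowSum_pow_three h0, expect_rowSum_pow_four h0, expect_rowSum_pow_five h0,
      expect_rowSum_pow_six h0]
    ring

end IndependentSums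

/-- Moment bounds shared by the normalized sign forms. -/
structure RowMoments {Ω : Type*} [Fintype Ω] (W : Ω → ℝ) : Prop where
  mean : 𝔼 a, W a = 0
  two : 𝔼 a, W a ^ 2 ≤ 2
  four : 𝔼 a, W a ^ 4 ≤ 200
  six : 𝔼 a, W a ^ 6 ≤ 332672
  eight : 𝔼 a, W a ^ 8 ≤ 259459328

lemma expect_even_pow_nonneg {Ω : Type*} [Fintype Ω] (W : Ω → ℝ) {n : ℕ} (h : Even n) :
    0 ≤ 𝔼 a, W a ^ n := Finset.expect_nonneg fun _ _ => h.pow_nonneg _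

section RowMoments

variable {Ω : Type*} [Fintype Ω] {W : Ω → ℝ} (h : RowMoments W)

include h

lemma RowMoments.three_sq : (𝔼 a, W a ^ 3) ^ 2 ≤ 400 := by
  have h1 := expect_mul_sq_le W (fun a => W a ^ 2)
  have e1 : ∀ a, W a * W a ^ 2 = W a ^ 3 := fun a => by ring
  have e2 : ∀ a, (W a ^ 2) ^ 2 = W a ^ 4 := fun a => by ring
  simp only [e1, e2] at h1
  have := mul_le_mul h.two h.four (expect_even_pow_nonneg W (by decide)) (by norm_num)
  linarith

lemma RowMoments.three_mul_five : (𝔼 a, W a ^ 3) * (𝔼 a, W a ^ 5) ≤ 164000 := by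
  have h1 := expect_mul_sq_le (fun a => W a ^ 2) (fun a => W a ^ 3)
  have e1 : ∀ a, W a ^ 2 * W a ^ 3 = W a ^ 5 := fun a => by ring
  have e2 : ∀ a, (W a ^ 2) ^ 2 = W a ^ 4 := fun a => by ring
  have e3 : ∀ a, (W a ^ 3) ^ 2 = W a ^ 6 := fun a => by ring
  simp only [e1, e2, e3] at h1
  have h5 : (𝔼 a, W a ^ 5) ^ 2 ≤ 8200 ^ 2 := by
    have := mul_le_mul h.four h.six (expect_even_pow_nonneg W (by decide)) (by norm_num)
    linarith
  have h3 : (𝔼 a, W a ^ 3) ^ 2 ≤ 20 ^ 2 := by linarith [h.three_sq]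
  have a3 := abs_le_of_sq_le_sq h3 (by norm_num)
  have a5 := abs_le_of_sq_le_sq h5 (by norm_num)
  calc _ ≤ |𝔼 a, W a ^ 3| * |𝔼 a, W a ^ 5| := by rw [← abs_mul]; exact le_abs_self _
    _ ≤ 20 * 8200 := by
        gcongr
    _ = _ := by norm_num

variable [Nonempty Ω]

lemma RowMoments.rowSum_pow_four_le {k : ℕ} (hk : 1 ≤ k) :
    𝔼 w : Fin k → Ω, rowSum W w ^ 4 ≤ 12 * k ^ 2 + 200 * k := by
  rw [expect_rowSum_pow_four h.mean]
  have hk' : (1 : ℝ) ≤ k := by exact_mod_cast hk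
  obtain ⟨κ, hκ⟩ : ∃ κ : ℝ, κ = k := ⟨_, rfl⟩
  rw [← hκ] at hk' ⊢
  have h2 := expect_even_pow_nonneg W (n := 2) (by decide)
  have h4 := h.four
  have : (𝔼 a, W a ^ 2) ^ 2 ≤ 4 := by nlinarith [h.two]
  calc _ ≤ κ * 200 + 3 * κ * (κ - 1) * 4 := by
        have : (0 : ℝ) ≤ κ - 1 := by linarith
        gcongr
    _ ≤ _ := by nlinarith

lemma RowMoments.rowSum_pow_six_le {k : ℕ} (hk : 709 ≤ k) :
    𝔼 w : Fin k → Ω, rowSum W w ^ 6 ≤ 135 * k ^ 3 := by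
  rw [expect_rowSum_pow_six h.mean]
  have hk' : (709 : ℝ) ≤ k := by exact_mod_cast hk
  obtain ⟨κ, hκ⟩ : ∃ κ : ℝ, κ = k := ⟨_, rfl⟩
  rw [← hκ] at hk' ⊢
  have h2 := expect_even_pow_nonneg W (n := 2) (by decide)
  have h4 := expect_even_pow_nonneg W (n := 4) (by decide)
  have b2 := h.two
  have b4 := h.four
  have b6 := h.six
  have k1 : (0 : ℝ) ≤ κ - 1 := by linarith
  have k2 : (0 : ℝ) ≤ κ - 2 := by linarith
  calc _ ≤ κ * 332672 + 15 * κ * (κ - 1) * 2 * 200 + 10 * κ * (κ - 1) * 400 +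
        15 * κ * (κ - 1) * (κ - 2) * 2 ^ 3 := by
        gcongr
        exact h.three_sq
    _ ≤ κ * 332672 + 15 * κ * κ * 2 * 200 + 10 * κ * κ * 400 + 15 * κ * κ * κ * 2 ^ 3 := by
        gcongr <;> linarith
    _ = κ * (332672 + 10000 * κ + 120 * κ ^ 2) := by ring
    _ ≤ κ * (135 * κ ^ 2) := by
        gcongr
        nlinarith
    _ = _ := by ring

lemma RowMoments.rowSum_pow_eight_le {k : ℕ} (hk : 1178 ≤ k) :
    𝔼 w : Fin k → Ω, rowSum W w ^ 8 ≤ 2100 * k ^ 4 := by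
  rw [expect_rowSum_pow_eight h.mean]
  have hk' : (1178 : ℝ) ≤ k := by exact_mod_cast hk
  obtain ⟨κ, hκ⟩ : ∃ κ : ℝ, κ = k := ⟨_, rfl⟩
  rw [← hκ] at hk' ⊢
  have h2 := expect_even_pow_nonneg W (n := 2) (by decide)
  have h4 := expect_even_pow_nonneg W (n := 4) (by decide)
  have h6 := expect_even_pow_nonneg W (n := 6) (by decide)
  have b2 := h.two
  have b4 := h.four
  have b6 := h.six
  have b8 := h.eight
  have b3 := h.three_sq
  have b35 := h.three_mul_five
  have k1 : (0 : ℝ) ≤ κ - 1 := by linarith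
  have k2 : (0 : ℝ) ≤ κ - 2 := by linarith
  have k3 : (0 : ℝ) ≤ κ - 3 := by linarith
  rw [mul_assoc 56]
  calc _ ≤ κ * 259459328 + κ * (κ - 1) * (28 * 2 * 332672 + 56 * 164000 + 35 * 200 ^ 2) +
        κ * (κ - 1) * (κ - 2) * (210 * 2 ^ 2 * 200 + 280 * 2 * 400) +
        105 * κ * (κ - 1) * (κ - 2) * (κ - 3) * 2 ^ 4 := by
        gcongr
    _ ≤ κ * 259459328 + κ * κ * (28 * 2 * 332672 + 56 * 164000 + 35 * 200 ^ 2) +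
        κ * κ * κ * (210 * 2 ^ 2 * 200 + 280 * 2 * 400) + 105 * κ * κ * κ * κ * 2 ^ 4 := by
        gcongr <;> linarith
    _ = κ * (259459328 + 29213632 * κ + 392000 * κ ^ 2 + 1680 * κ ^ 3) := by ring
    _ ≤ κ * (2100 * κ ^ 3) := by
        have e2 : 1178 * κ ≤ κ ^ 2 := by nlinarith
        have e3 : 1178 * κ ^ 2 ≤ κ ^ 3 := by nlinarith [sq_nonneg κ]
        gcongr
        linarith
    _ = _ := by ring

end RowMoments

lemma signForm_rowMoments {d : ℕ} {α β : ℝ} (hα : 0 ≤ α) (hβ : 0 ≤ β) (u v : Fin d → ℝ)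
    (huv : u ⬝ᵥ v = 0) (hF : (α * (u ⬝ᵥ u)) ^ 2 + (β * (v ⬝ᵥ v)) ^ 2 ≤ 1) :
    RowMoments (signForm α β u v) := by
  have nn : ∀ x : Fin d → ℝ, 0 ≤ x ⬝ᵥ x := fun x =>
    Finset.sum_nonneg fun i _ => mul_self_nonneg _
  have ha : 0 ≤ α * (u ⬝ᵥ u) := mul_nonneg hα (nn u)
  have hb : 0 ≤ β * (v ⬝ᵥ v) := mul_nonneg hβ (nn v)
  set Z : (Fin d → Bool) → ℝ := fun s =>
    α * rademacherSum u s ^ 2 - β * rademacherSum v s ^ 2 with hZ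
  have hZ2 : 𝔼 s, Z s ^ 2 ≤ (α * (u ⬝ᵥ u) - β * (v ⬝ᵥ v)) ^ 2 +
        2 * ((α * (u ⬝ᵥ u)) ^ 2 + (β * (v ⬝ᵥ v)) ^ 2) := expect_quadratic_sq_le α β u v huv
  have hZ1 : 𝔼 s, Z s = α * (u ⬝ᵥ u) - β * (v ⬝ᵥ v) := expect_quadratic α β u v
  have hW : ∀ s, signForm α β u v s = Z s + -(α * (u ⬝ᵥ u) - β * (v ⬝ᵥ v)) := fun s => rfl
  have hpow : ∀ l : ℕ, l ≠ 0 →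
      𝔼 s, Z s ^ (2 * l) ≤ (2 * (2 * l)).factorial / (2 ^ (2 * l) * (2 * l).factorial) := by
    intro l hl
    have h1 := expect_mul_rademacherSum_sq_pow_le u hα (2 * l)
    have h2 := expect_mul_rademacherSum_sq_pow_le v hβ (2 * l)
    have h3 : 𝔼 s, Z s ^ (2 * l) ≤ 𝔼 s, ((α * rademacherSum u s ^ 2) ^ (2 * l) +
        (β * rademacherSum v s ^ 2) ^ (2 * l)) := by
      refine expect_mono fun s => ?_
      have hX : 0 ≤ α * rademacherSum u s ^ 2 := by positivity
      have hY : 0 ≤ β * rademacherSum v s ^ 2 := by positivity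
      rcases le_total (α * rademacherSum u s ^ 2) (β * rademacherSum v s ^ 2) with hxy | hxy
      · rw [← (even_two_mul l).neg_pow (Z s)]
        have : (-Z s) ^ (2 * l) ≤ (β * rademacherSum v s ^ 2) ^ (2 * l) := by
          apply pow_le_pow_left₀ <;> simp only [hZ] <;> linarith
        linarith [pow_nonneg hX (2 * l)]
      · have : Z s ^ (2 * l) ≤ (α * rademacherSum u s ^ 2) ^ (2 * l) := by
          apply pow_le_pow_left₀ <;> simp only [hZ] <;> linarith
        linarith [pow_nonneg hY (2 * l)]
    rw [Finset.expect_add_distrib] at h3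
    have h4 : (α * (u ⬝ᵥ u)) ^ (2 * l) + (β * (v ⬝ᵥ v)) ^ (2 * l) ≤ 1 := by
      rw [pow_mul, pow_mul]
      exact (pow_add_pow_le (sq_nonneg _) (sq_nonneg _) hl).trans
        (pow_le_one₀ (by positivity) hF)
    calc _ ≤ _ := h3
      _ ≤ _ := add_le_add h1 h2
      _ = (2 * (2 * l)).factorial / (2 ^ (2 * l) * (2 * l).factorial) *
          ((α * (u ⬝ᵥ u)) ^ (2 * l) + (β * (v ⬝ᵥ v)) ^ (2 * l)) := by ring
      _ ≤ _ := mul_le_of_le_one_right (by positivity) h4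
  set a := α * (u ⬝ᵥ u)
  set b := β * (v ⬝ᵥ v)
  have hc : (a - b) ^ 2 ≤ 1 := by nlinarith
  have hc' : ∀ l : ℕ, (-(a - b)) ^ (2 * l) ≤ 1 := fun l => by
    rw [pow_mul, neg_sq]
    exact pow_le_one₀ (sq_nonneg _) hc
  have hconv : ∀ l : ℕ, l ≠ 0 → 𝔼 s, signForm α β u v s ^ (2 * l) ≤
      2 ^ (2 * l - 1) * ((2 * (2 * l)).factorial / (2 ^ (2 * l) * (2 * l).factorial) + 1) := by
    intro l hl
    have h1 : 𝔼 s, signForm α β u v s ^ (2 * l) ≤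
        𝔼 s, 2 ^ (2 * l - 1) * (Z s ^ (2 * l) + (-(a - b)) ^ (2 * l)) :=
      expect_mono fun s => by
        rw [hW]
        exact (even_two_mul l).add_pow_le
    rw [← Finset.mul_expect, Finset.expect_add_distrib, Fintype.expect_const] at h1
    exact h1.trans (mul_le_mul_of_nonneg_left (add_le_add (hpow l hl) (hc' l)) (by positivity))
  refine ⟨expect_signForm α β u v, ?_, ?_, ?_, ?_⟩
  · linarith [expect_signForm_sq_le α β u v huv]
  · have h4 := hpow 2 (by norm_num)
    norm_num [Nat.factorial] at h4
    have h1 : 𝔼 s, signForm α β u v s ^ 4 ≤ 𝔼 s, (3 / 2 * Z s ^ 4 +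
        14 * (a - b) ^ 2 * Z s ^ 2 - 4 * (a - b) ^ 3 * Z s + (a - b) ^ 4) :=
      expect_mono fun s => by
        rw [hW]
        nlinarith [sq_nonneg (Z s * (Z s + 4 * (a - b)))]
    simp only [Finset.expect_add_distrib, Finset.expect_sub_distrib, ← Finset.mul_expect,
      Fintype.expect_const, hZ1] at h1
    have h2 : 𝔼 s, Z s ^ 2 ≤ 3 := by linarith
    have h3 : (a - b) ^ 2 * 𝔼 s, Z s ^ 2 ≤ 1 * 3 :=
      mul_le_mul hc h2 (expect_even_pow_nonneg Z (by decide)) (by norm_num)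
    nlinarith [sq_nonneg ((a - b) ^ 2)]
  · have := hconv 3 (by norm_num)
    norm_num [Nat.factorial] at this
    linarith
  · have := hconv 4 (by norm_num)
    norm_num [Nat.factorial] at this
    linarith

lemma cubic_le_exp (z : ℝ) : 1 + z + z ^ 2 / 2 + z ^ 3 / 6 ≤ Real.exp z := by
  rcases le_total 0 z with hz | hz
  · have := Real.sum_le_exp_of_nonneg hz 4
    simp [Finset.sum_range_succ, Nat.factorial] at this
    linarith
  · have hd : ∀ t : ℝ, HasDerivAt (fun t : ℝ => Real.exp t - 1 - t - t ^ 2 / 2 - t ^ 3 / 6)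
        (Real.exp t - 1 - t - t ^ 2 / 2) t := by
      intro t
      have := ((((Real.hasDerivAt_exp t).sub_const 1).sub (hasDerivAt_id t)).sub
        ((hasDerivAt_pow 2 t).div_const 2)).sub ((hasDerivAt_pow 3 t).div_const 6)
      refine this.congr_deriv ?_
      simp
      ring
    have ha : AntitoneOn (fun t : ℝ => Real.exp t - 1 - t - t ^ 2 / 2 - t ^ 3 / 6)
        (Set.Iic 0) := by
      refine antitoneOn_of_deriv_nonpos (convex_Iic 0)
        (fun t _ => (hd t).continuousAt.continuousWithinAt)
        (fun t _ => (hd t).differentiableAt.differentiableWithinAt) fun t ht => ?_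
      rw [interior_Iic] at ht
      rw [(hd t).deriv]
      have := exp_remainder_mono (le_of_lt ht)
      simpa using this
    have := ha hz (Set.mem_Iic.mpr le_rfl) hz
    simp at this
    linarith

lemma expect_exp_quadratic_le {d : ℕ} {α β : ℝ} (hα : 0 ≤ α) (hβ : 0 ≤ β) (u v : Fin d → ℝ)
    (huv : u ⬝ᵥ v = 0) {h : ℝ} (h0 : 0 < h) (hs : 2 * (h * (α * (u ⬝ᵥ u))) < 1) :
    𝔼 s, Real.exp (h * (α * rademacherSum u s ^ 2 - β * rademacherSum v s ^ 2)) ≤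
      1 + h * (α * (u ⬝ᵥ u) - β * (v ⬝ᵥ v)) + h ^ 2 / 2 * ((α * (u ⬝ᵥ u) - β * (v ⬝ᵥ v)) ^ 2 +
        2 * ((α * (u ⬝ᵥ u)) ^ 2 + (β * (v ⬝ᵥ v)) ^ 2)) +
      5 / 2 * (h * (α * (u ⬝ᵥ u))) ^ 3 / (1 - 2 * (h * (α * (u ⬝ᵥ u)))) := by
  have hu : 0 ≤ u ⬝ᵥ u := Finset.sum_nonneg fun i _ => mul_self_nonneg _
  have hrem := expect_exp_remainder_le u (α := h * α) (by positivity)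
    (by rwa [mul_assoc]) hu
  have hsq := expect_quadratic_sq_le α β u v huv
  have hmean := expect_quadratic α β u v
  simp only [mul_assoc] at hrem
  have hpt : 𝔼 s, Real.exp (h * (α * rademacherSum u s ^ 2 - β * rademacherSum v s ^ 2)) ≤
      𝔼 s, (1 + h * (α * rademacherSum u s ^ 2 - β * rademacherSum v s ^ 2) +
        h ^ 2 / 2 * (α * rademacherSum u s ^ 2 - β * rademacherSum v s ^ 2) ^ 2 +
        (Real.exp (h * (α * rademacherSum u s ^ 2)) - 1 - h * (α * rademacherSum u s ^ 2) -
          (h * (α * rademacherSum u s ^ 2)) ^ 2 / 2)) := by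
    refine expect_mono fun s => ?_
    have hY : 0 ≤ β * rademacherSum v s ^ 2 := by positivity
    have := exp_remainder_mono (mul_le_mul_of_nonneg_left
      (show α * rademacherSum u s ^ 2 - β * rademacherSum v s ^ 2 ≤ α * rademacherSum u s ^ 2
        by linarith) h0.le)
    rw [mul_pow h (α * rademacherSum u s ^ 2 - β * rademacherSum v s ^ 2)] at this
    linarith
  rw [Finset.expect_add_distrib, Finset.expect_add_distrib, Finset.expect_add_distrib,
    ← Finset.mul_expect, ← Finset.mul_expect, Fintype.expect_const, hmean] at hpt
  have := mul_le_mul_of_nonneg_left hsq (show 0 ≤ h ^ 2 / 2 by positivity)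
  linarith

lemma quadratic_bound_le_exp {a b h : ℝ} (ha : 0 ≤ a) (hb : 0 ≤ b) (hF : a ^ 2 + b ^ 2 ≤ 1)
    (h0 : 0 < h) (h1 : h ≤ 7 / 100) :
    1 + h * (a - b) + h ^ 2 / 2 * ((a - b) ^ 2 + 2 * (a ^ 2 + b ^ 2)) +
      5 / 2 * (h * a) ^ 3 / (1 - 2 * (h * a)) ≤
    Real.exp (h * (a - b) + (h ^ 2 + 2 * h ^ 3)) := by
  refine le_trans ?_ (cubic_le_exp _)
  have ha1 : a ≤ 1 := by nlinarith
  have hb1 : b ≤ 1 := by nlinarith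
  have hha : h * a ≤ 7 / 100 := by nlinarith
  have hfrac : 5 / 2 * (h * a) ^ 3 / (1 - 2 * (h * a)) ≤ 2.907 * (h ^ 3 * a ^ 3) := by
    rw [div_le_iff₀ (by linarith)]
    have : 0 ≤ h ^ 3 * a ^ 3 := by positivity
    rw [mul_pow]
    nlinarith
  have key : 0 ≤ h ^ 2 * (1 - (a ^ 2 + b ^ 2)) + 2 * h ^ 3 + h ^ 3 * (a - b) * (1 + 2 * h) +
      (h ^ 2 + 2 * h ^ 3) ^ 2 / 2 + (h * (a - b) + (h ^ 2 + 2 * h ^ 3)) ^ 3 / 6 -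
      2.907 * (h ^ 3 * a ^ 3) := by
    have hF' : 0 ≤ h ^ 2 * (1 - (a ^ 2 + b ^ 2)) := mul_nonneg (sq_nonneg h) (by linarith)
    have hh3 : 0 < h ^ 3 := by positivity
    rcases le_total b a with hab | hab
    · have e1 : 0 ≤ (h * (a - b) + (h ^ 2 + 2 * h ^ 3)) ^ 3 := by
        have : 0 ≤ a - b := by linarith
        positivity
      have e2 : 0 ≤ 2 * h ^ 3 * (a - b) * h := by
        have : 0 ≤ a - b := by linarith
        positivity
      have e3 : 0 ≤ 2 + (a - b) - 2.907 * a ^ 3 := by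
        rcases le_total a 0.8 with h8 | h8
        · nlinarith [mul_nonneg ha (sub_nonneg.mpr h8), mul_nonneg (mul_nonneg ha ha)
            (sub_nonneg.mpr h8)]
        · have : 0.3 * b ≤ 1 - a ^ 2 + 0.0225 := by nlinarith [sq_nonneg (b - 0.15)]
          nlinarith [mul_nonneg (sub_nonneg.mpr h8) (sub_nonneg.mpr ha1),
            mul_nonneg ha (mul_nonneg (sub_nonneg.mpr h8) (sub_nonneg.mpr ha1))]
      have e4 := mul_nonneg hh3.le e3
      nlinarith [sq_nonneg (h ^ 2 + 2 * h ^ 3)]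
    · have hc3 : (h * (a - b)) ^ 3 ≤ (h * (a - b) + (h ^ 2 + 2 * h ^ 3)) ^ 3 := by
        apply Odd.pow_le_pow (by decide) |>.mpr
        nlinarith [sq_nonneg h]
      have e1 : a - b ≤ (a - b) ^ 3 := by
        nlinarith [mul_nonneg (mul_nonneg (sub_nonneg.mpr hab)
          (show 0 ≤ 1 - (b - a) by linarith)) (show 0 ≤ 1 + (b - a) by linarith)]
      have e2 : h ^ 3 * (a - b) ≤ (h * (a - b)) ^ 3 := by
        rw [mul_pow]; exact mul_le_mul_of_nonneg_left e1 hh3.le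
      have e3 : 0 ≤ 2 + 1.31 * (a - b) - 2.907 * a ^ 3 := by
        have : a ≤ 0.71 := by nlinarith
        nlinarith [mul_nonneg ha (sub_nonneg.mpr this), mul_nonneg (mul_nonneg ha ha)
            (sub_nonneg.mpr this)]
      have e4 := mul_nonneg hh3.le e3
      have e5 : 0 ≤ h ^ 3 * (b - a) * (0.14 - 2 * h) :=
        mul_nonneg (mul_nonneg hh3.le (by linarith)) (by linarith)
      have e6 : 0 ≤ h ^ 3 * (b - a) := mul_nonneg hh3.le (by linarith)
      nlinarith [sq_nonneg (h ^ 2 + 2 * h ^ 3)]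
  nlinarith [key, hfrac]

/-- Moment generating function of a normalized sign form. -/
lemma expect_exp_signForm_le {d : ℕ} {α β : ℝ} (hα : 0 ≤ α) (hβ : 0 ≤ β) (u v : Fin d → ℝ)
    (huv : u ⬝ᵥ v = 0) (hF : (α * (u ⬝ᵥ u)) ^ 2 + (β * (v ⬝ᵥ v)) ^ 2 ≤ 1) {h : ℝ} (h0 : 0 < h)
    (h1 : h ≤ 7 / 100) :
    𝔼 s, Real.exp (h * signForm α β u v s) ≤ Real.exp (h ^ 2 + 2 * h ^ 3) := by
  have ha : 0 ≤ α * (u ⬝ᵥ u) :=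
    mul_nonneg hα (Finset.sum_nonneg fun i _ => mul_self_nonneg _)
  have hb : 0 ≤ β * (v ⬝ᵥ v) :=
    mul_nonneg hβ (Finset.sum_nonneg fun i _ => mul_self_nonneg _)
  have ha1 : α * (u ⬝ᵥ u) ≤ 1 := by nlinarith
  have hq := (expect_exp_quadratic_le hα hβ u v huv h0 (by nlinarith)).trans
    (quadratic_bound_le_exp ha hb hF h0 h1)
  have he : ∀ s, Real.exp (h * signForm α β u v s) =
      Real.exp (h * (α * rademacherSum u s ^ 2 - β * rademacherSum v s ^ 2)) *
        Real.exp (-(h * (α * (u ⬝ᵥ u) - β * (v ⬝ᵥ v)))) := by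
    intro s
    rw [← Real.exp_add, signForm]
    ring_nf
  simp only [he]
  rw [← Finset.expect_mul]
  calc _ ≤ Real.exp (h * (α * (u ⬝ᵥ u) - β * (v ⬝ᵥ v)) + (h ^ 2 + 2 * h ^ 3)) *
        Real.exp (-(h * (α * (u ⬝ᵥ u) - β * (v ⬝ᵥ v)))) := by gcongr
    _ = _ := by rw [← Real.exp_add]; ring_nf

open Classical in
/-- The probability of `P` under the uniform distribution on a finite type. -/
noncomputable def uniformProb {Ω : Type*} [Fintype Ω] (P : Ω → Prop) : ℝ :=
  𝔼 w, if P w then 1 else 0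

lemma uniformProb_le_expect {Ω : Type*} [Fintype Ω] {P : Ω → Prop} {f : Ω → ℝ}
    (h0 : ∀ w, 0 ≤ f w) (h : ∀ w, P w → 1 ≤ f w) : uniformProb P ≤ 𝔼 w, f w := by
  refine expect_mono fun w => ?_
  split_ifs with hw
  · exact h w hw
  · exact h0 w

lemma uniformProb_mono {Ω : Type*} [Fintype Ω] {P Q : Ω → Prop} (h : ∀ w, P w → Q w) :
    uniformProb P ≤ uniformProb Q := by
  refine uniformProb_le_expect (fun w => ?_) fun w hw => ?_
  · split_ifs <;> norm_num
  · rw [if_pos (h w hw)]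

lemma uniformProb_lt_abs_le {Ω : Type*} [Fintype Ω] (f : Ω → ℝ) {T : ℝ} (hT : 0 < T) {p : ℕ}
    (hp : Even p) : uniformProb (fun w => T < |f w|) ≤ (𝔼 w, f w ^ p) / T ^ p := by
  rw [Finset.expect_div]
  refine uniformProb_le_expect (fun w => ?_) fun w hw => ?_
  · exact div_nonneg (hp.pow_nonneg _) (by positivity)
  · rw [le_div_iff₀ (by positivity), one_mul, ← hp.pow_abs (f w)]
    exact pow_le_pow_left₀ hT.le hw.le p

/-- Every normalized average of `k` independent sign forms exceeds `t` in absolute value with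
probability at most `τ`. -/
def SignFormTail (d k : ℕ) (t τ : ℝ) : Prop :=
  ∀ (α β : ℝ) (u v : Fin d → ℝ), 0 ≤ α → 0 ≤ β → u ⬝ᵥ v = 0 →
    (α * (u ⬝ᵥ u)) ^ 2 + (β * (v ⬝ᵥ v)) ^ 2 ≤ 1 →
    uniformProb (fun w : Fin k → Fin d → Bool => k * t < |rowSum (signForm α β u v) w|) ≤ τ

lemma SignFormTail.mono {d k : ℕ} {t t' τ τ' : ℝ} (h : SignFormTail d k t τ) (ht : t ≤ t')
    (hτ : τ ≤ τ') : SignFormTail d k t' τ' := fun α β u v hα hβ huv hF =>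
  (uniformProb_mono fun _ hw => (mul_le_mul_of_nonneg_left ht k.cast_nonneg).trans_lt hw).trans
    ((h α β u v hα hβ huv hF).trans hτ)

lemma rowSum_signForm_mul {d k : ℕ} (c α β : ℝ) (u v : Fin d → ℝ) (w : Fin k → Fin d → Bool) :
    rowSum (signForm (c * α) (c * β) u v) w = c * rowSum (signForm α β u v) w := by
  simp only [rowSum, Finset.mul_sum, signForm]
  refine Finset.sum_congr rfl fun i _ => ?_
  ring

lemma SignFormTail.scaled {d k : ℕ} {t τ : ℝ} (h : SignFormTail d k t τ) {c α β : ℝ} (hc : 0 < c)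
    (hα : 0 ≤ α) (hβ : 0 ≤ β) (u v : Fin d → ℝ) (huv : u ⬝ᵥ v = 0)
    (hF : (α * (u ⬝ᵥ u)) ^ 2 + (β * (v ⬝ᵥ v)) ^ 2 ≤ c ^ 2) :
    uniformProb (fun w : Fin k → Fin d → Bool =>
      k * (c * t) < |rowSum (signForm α β u v) w|) ≤ τ := by
  refine le_trans (uniformProb_mono fun w hw => ?_)
    (h (c⁻¹ * α) (c⁻¹ * β) u v (by positivity) (by positivity) huv ?_)
  · rw [rowSum_signForm_mul, abs_mul, abs_of_pos (inv_pos.mpr hc), lt_inv_mul_iff₀ hc]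
    linarith
  · calc _ = (c ^ 2)⁻¹ * ((α * (u ⬝ᵥ u)) ^ 2 + (β * (v ⬝ᵥ v)) ^ 2) := by
          field_simp
      _ ≤ (c ^ 2)⁻¹ * c ^ 2 := by gcongr
      _ = 1 := inv_mul_cancel₀ (by positivity)

lemma signFormTail_four (d : ℕ) {k : ℕ} (hk : 1 ≤ k) {t : ℝ} (ht : 0 < t) :
    SignFormTail d k t ((12 + 200 / k) / (k ^ 2 * t ^ 4)) := by
  intro α β u v hα hβ huv hF
  have hk' : (0 : ℝ) < k := by exact_mod_cast hk
  refine (uniformProb_lt_abs_le _ (by positivity) (show Even 4 by decide)).trans ?_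
  have := (signForm_rowMoments hα hβ u v huv hF).rowSum_pow_four_le hk
  rw [div_le_div_iff₀ (by positivity) (by positivity)]
  calc _ ≤ (12 * k ^ 2 + 200 * k) * ((k : ℝ) ^ 2 * t ^ 4) := by gcongr
    _ = _ := by field_simp

lemma signFormTail_six (d : ℕ) {k : ℕ} (hk : 709 ≤ k) {t : ℝ} (ht : 0 < t) :
    SignFormTail d k t (135 / (k ^ 3 * t ^ 6)) := by
  intro α β u v hα hβ huv hF
  have hk' : (0 : ℝ) < k := by exact_mod_cast (by omega : 0 < k)
  refine (uniformProb_lt_abs_le _ (by positivity) (show Even 6 by decide)).trans ?_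
  have := (signForm_rowMoments hα hβ u v huv hF).rowSum_pow_six_le hk
  rw [div_le_div_iff₀ (by positivity) (by positivity)]
  calc _ ≤ (135 * k ^ 3) * ((k : ℝ) ^ 3 * t ^ 6) := by gcongr
    _ = _ := by ring

lemma signFormTail_eight (d : ℕ) {k : ℕ} (hk : 1178 ≤ k) {t : ℝ} (ht : 0 < t) :
    SignFormTail d k t (2100 / (k ^ 4 * t ^ 8)) := by
  intro α β u v hα hβ huv hF
  have hk' : (0 : ℝ) < k := by exact_mod_cast (by omega : 0 < k)
  refine (uniformProb_lt_abs_le _ (by positivity) (show Even 8 by decide)).trans ?_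
  have := (signForm_rowMoments hα hβ u v huv hF).rowSum_pow_eight_le hk
  rw [div_le_div_iff₀ (by positivity) (by positivity)]
  calc _ ≤ (2100 * k ^ 4) * ((k : ℝ) ^ 4 * t ^ 8) := by gcongr
    _ = _ := by ring

lemma expect_exp_rowSum_signForm_le {d k : ℕ} {α β : ℝ} (hα : 0 ≤ α) (hβ : 0 ≤ β)
    (u v : Fin d → ℝ) (huv : u ⬝ᵥ v = 0)
    (hF : (α * (u ⬝ᵥ u)) ^ 2 + (β * (v ⬝ᵥ v)) ^ 2 ≤ 1) {h : ℝ} (h0 : 0 < h) (h1 : h ≤ 7 / 100) :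
    𝔼 w : Fin k → Fin d → Bool, Real.exp (h * rowSum (signForm α β u v) w) ≤
      Real.exp (k * (h ^ 2 + 2 * h ^ 3)) := by
  rw [expect_exp_rowSum, Real.exp_nat_mul]
  exact pow_le_pow_left₀ (Finset.expect_nonneg fun _ _ => (Real.exp_pos _).le)
    (expect_exp_signForm_le hα hβ u v huv hF h0 h1) k

lemma signFormTail_exp (d k : ℕ) {t : ℝ} (ht : 0 < t) (ht1 : t ≤ 7 / 50) :
    SignFormTail d k t (2 * Real.exp (-(k * t ^ 2 * (1 - t) / 4))) := by
  intro α β u v hα hβ huv hF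
  set W := signForm α β u v with hW
  have hneg : ∀ w : Fin k → Fin d → Bool, rowSum (signForm β α v u) w = -rowSum W w := by
    intro w
    simp only [rowSum, hW, signForm, ← Finset.sum_neg_distrib]
    refine Finset.sum_congr rfl fun i _ => ?_
    ring
  have h1 := expect_exp_rowSum_signForm_le (k := k) hα hβ u v huv hF (half_pos ht) (by linarith)
  have h2 := expect_exp_rowSum_signForm_le (k := k) hβ hα v u (by rwa [dotProduct_comm])
    (by linarith) (half_pos ht) (by linarith)
  simp only [hneg] at h2
  calc _ ≤ 𝔼 w : Fin k → Fin d → Bool, (Real.exp (-(k * t ^ 2 / 2)) *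
        (Real.exp (t / 2 * rowSum W w) + Real.exp (t / 2 * -rowSum W w))) := by
        refine uniformProb_le_expect (fun w => by positivity) fun w hw => ?_
        rw [mul_add, ← Real.exp_add, ← Real.exp_add]
        have key : ∀ x : ℝ, k * t < x → 1 ≤ Real.exp (-(k * t ^ 2 / 2) + t / 2 * x) := by
          intro x hx
          apply Real.one_le_exp
          nlinarith
        rcases lt_abs.mp hw with hw | hw
        · linarith [key _ hw, Real.exp_pos (-(k * t ^ 2 / 2) + t / 2 * -rowSum W w)]
        · linarith [key _ hw, Real.exp_pos (-(k * t ^ 2 / 2) + t / 2 * rowSum W w)]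
    _ ≤ Real.exp (-(k * t ^ 2 / 2)) * (Real.exp (k * ((t / 2) ^ 2 + 2 * (t / 2) ^ 3)) +
        Real.exp (k * ((t / 2) ^ 2 + 2 * (t / 2) ^ 3))) := by
        rw [← Finset.mul_expect, Finset.expect_add_distrib]
        gcongr
    _ = _ := by
        rw [← two_mul, mul_left_comm, ← Real.exp_add]
        ring_nf

/-- `k` times the error of the inner product of the random images of `x` and `y`. -/
def gramError {d k : ℕ} (x y : Fin d → ℝ) (w : Fin k → Fin d → Bool) : ℝ :=
  rowSum (fun s => rademacherSum x s * rademacherSum y s - x ⬝ᵥ y) w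

lemma gramError_comm {d k : ℕ} (x y : Fin d → ℝ) (w : Fin k → Fin d → Bool) :
    gramError x y w = gramError y x w := by
  simp only [gramError, dotProduct_comm x y, mul_comm (rademacherSum x _)]

lemma gramError_neg_right {d k : ℕ} (x y : Fin d → ℝ) (w : Fin k → Fin d → Bool) :
    gramError x (-y) w = -gramError x y w := by
  simp only [gramError, rowSum, rademacherSum_neg, dotProduct_neg, ← Finset.sum_neg_distrib]
  refine Finset.sum_congr rfl fun i _ => ?_
  ring

lemma gramError_neg_neg {d k : ℕ} (x y : Fin d → ℝ) (w : Fin k → Fin d → Bool) :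
    gramError (-x) (-y) w = gramError x y w := by
  rw [gramError_neg_right, gramError_comm, gramError_neg_right, neg_neg, gramError_comm]

lemma gramError_self {d k : ℕ} (x : Fin d → ℝ) (w : Fin k → Fin d → Bool) :
    gramError x x w = rowSum (signForm 1 0 x 0) w := by
  simp only [gramError, rowSum, signForm]
  refine Finset.sum_congr rfl fun i _ => ?_
  ring

lemma dotProduct_add_self {d : ℕ} (x y : Fin d → ℝ) :
    (x + y) ⬝ᵥ (x + y) = x ⬝ᵥ x + 2 * (x ⬝ᵥ y) + y ⬝ᵥ y := by
  rw [add_dotProduct, dotProduct_add, dotProduct_add, dotProduct_comm y x]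
  ring

lemma dotProduct_sub_self {d : ℕ} (x y : Fin d → ℝ) :
    (x - y) ⬝ᵥ (x - y) = x ⬝ᵥ x - 2 * (x ⬝ᵥ y) + y ⬝ᵥ y := by
  rw [sub_dotProduct, dotProduct_sub, dotProduct_sub, dotProduct_comm y x]
  ring

lemma dotProduct_add_sub {d : ℕ} (x y : Fin d → ℝ) :
    (x + y) ⬝ᵥ (x - y) = x ⬝ᵥ x - y ⬝ᵥ y := by
  rw [add_dotProduct, dotProduct_sub, dotProduct_sub, dotProduct_comm y x]
  ring

lemma rowSum_signForm_add_sub {d k : ℕ} (α β : ℝ) (x y : Fin d → ℝ) (w : Fin k → Fin d → Bool) :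
    rowSum (signForm α β (x + y) (x - y)) w =
      2 * (α + β) * gramError x y w + (α - β) * (gramError x x w + gramError y y w) := by
  simp only [gramError, rowSum, signForm, Finset.mul_sum, ← Finset.sum_add_distrib,
    rademacherSum_add, rademacherSum_sub, dotProduct_add_self, dotProduct_sub_self]
  refine Finset.sum_congr rfl fun i _ => ?_
  ring

lemma SignFormTail.gramError_self {d k : ℕ} {t τ : ℝ} (h : SignFormTail d k t τ)
    (x : Fin d → ℝ) (hx : x ⬝ᵥ x = 1) :
    uniformProb (fun w : Fin k → Fin d → Bool => k * t < |gramError x x w|) ≤ τ := by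
  simp only [_root_.gramError_self]
  exact h 1 0 x 0 (by norm_num) le_rfl (dotProduct_zero x) (by simp [hx])

lemma SignFormTail.gramError_pair_of_nonneg {d k : ℕ} {ε t τ : ℝ}
    (hg : 0 < 5 / 2 - 3 / 2 * t) (hg2 : 229 * (5 / 2 - 3 / 2 * t) ^ 2 ≤ 289)
    (h : SignFormTail d k ((5 / 2 - 3 / 2 * t) * ε) τ) (x y : Fin d → ℝ)
    (hx : x ⬝ᵥ x = 1) (hy : y ⬝ᵥ y = 1) (hxy : 0 ≤ x ⬝ᵥ y) :
    uniformProb (fun w : Fin k → Fin d → Bool => k * ε < |gramError x y w| ∧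
      |gramError x x w| ≤ k * (t * ε) ∧ |gramError y y w| ≤ k * (t * ε)) ≤ τ := by
  set g := 5 / 2 - 3 / 2 * t with hgdef
  have horth : (x + y) ⬝ᵥ (x - y) = 0 := by rw [dotProduct_add_sub, hx, hy, sub_self]
  have hle : x ⬝ᵥ y ≤ 1 := by
    have : 0 ≤ (x - y) ⬝ᵥ (x - y) := Finset.sum_nonneg fun i _ => mul_self_nonneg _
    rw [dotProduct_sub_self, hx, hy] at this
    linarith
  rcases le_total (x ⬝ᵥ y) (13 / 17) with hρ | hρ
  · refine le_trans (uniformProb_mono fun w hw => ?_)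
      (h.scaled (c := 1 / g) (α := 1 / 4) (β := 1 / 4) (by positivity) (by norm_num) (by norm_num)
        (x + y) (x - y) horth ?_)
    · rw [rowSum_signForm_add_sub, show k * (1 / g * (g * ε)) = k * ε by field_simp]
      norm_num
      exact hw.1
    · rw [dotProduct_add_self, dotProduct_sub_self, hx, hy, div_pow, le_div_iff₀ (by positivity)]
      have h1 : (1 / 4 * (1 + 2 * x ⬝ᵥ y + 1)) ^ 2 + (1 / 4 * (1 - 2 * x ⬝ᵥ y + 1)) ^ 2 ≤
          229 / 289 := by nlinarith
      nlinarith [sq_nonneg g]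
  · refine le_trans (uniformProb_mono fun w hw => ?_)
      (h.scaled (c := 2 / 5) (α := 1 / 10) (β := 2 / 5) (by positivity) (by norm_num)
        (by norm_num) (x + y) (x - y) horth ?_)
    · rw [rowSum_signForm_add_sub]
      obtain ⟨h1, h2, h3⟩ := hw
      have h4 := abs_le.mp h2
      have h5 := abs_le.mp h3
      have e : (k : ℝ) * (2 / 5 * (g * ε)) = k * ε - 3 / 5 * (k * (t * ε)) := by
        rw [hgdef]; ring
      rw [e]
      rcases lt_abs.mp h1 with h1 | h1
      · refine lt_abs.mpr (Or.inl ?_)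
        linarith
      · refine lt_abs.mpr (Or.inr ?_)
        linarith
    · rw [dotProduct_add_self, dotProduct_sub_self, hx, hy]
      nlinarith

lemma SignFormTail.gramError_pair {d k : ℕ} {ε t τ : ℝ}
    (hg : 0 < 5 / 2 - 3 / 2 * t) (hg2 : 229 * (5 / 2 - 3 / 2 * t) ^ 2 ≤ 289)
    (h : SignFormTail d k ((5 / 2 - 3 / 2 * t) * ε) τ) (x y : Fin d → ℝ)
    (hx : x ⬝ᵥ x = 1) (hy : y ⬝ᵥ y = 1) :
    uniformProb (fun w : Fin k → Fin d → Bool => k * ε < |gramError x y w| ∧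
      |gramError x x w| ≤ k * (t * ε) ∧ |gramError y y w| ≤ k * (t * ε)) ≤ τ := by
  rcases le_total 0 (x ⬝ᵥ y) with hxy | hxy
  · exact h.gramError_pair_of_nonneg hg hg2 x y hx hy hxy
  · have := h.gramError_pair_of_nonneg hg hg2 x (-y) hx (by simpa using hy) (by simpa using hxy)
    simp only [gramError_neg_neg] at this
    simpa only [gramError_neg_right, abs_neg] using this

lemma exists_gramError_le_of_tails {d k n : ℕ} {ε t τ₁ τ₂ : ℝ} (S : Finset (Fin d → ℝ))
    (hcard : S.card ≤ n) (hunit : ∀ x ∈ S, x ⬝ᵥ x = 1) (hε : 0 ≤ ε) (ht : t ≤ 1)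
    (hg2 : 229 * (5 / 2 - 3 / 2 * t) ^ 2 ≤ 289) (h1 : SignFormTail d k (t * ε) τ₁)
    (h2 : SignFormTail d k ((5 / 2 - 3 / 2 * t) * ε) τ₂) (hτ₁ : 0 ≤ τ₁) (hτ₂ : 0 ≤ τ₂)
    (hsum : n * τ₁ + n * (n - 1) / 2 * τ₂ < 1) :
    ∃ w : Fin k → Fin d → Bool, ∀ x ∈ S, ∀ y ∈ S, |gramError x y w| ≤ k * ε := by
  classical
  by_contra hcon
  push Not at hcon
  set D : (Fin d → ℝ) → (Fin k → Fin d → Bool) → Prop := fun x w =>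
    k * (t * ε) < |gramError x x w| with hD
  set B : (Fin d → ℝ) × (Fin d → ℝ) → (Fin k → Fin d → Bool) → Prop := fun p w =>
    k * ε < |gramError p.1 p.2 w| ∧ |gramError p.1 p.1 w| ≤ k * (t * ε) ∧
      |gramError p.2 p.2 w| ≤ k * (t * ε) with hB
  have hΦ : ∀ w : Fin k → Fin d → Bool, (1 : ℝ) ≤ ∑ x ∈ S, (if D x w then (1 : ℝ) else 0) +
      1 / 2 * ∑ p ∈ S.offDiag, (if B p w then (1 : ℝ) else 0) := by
    intro w
    have nn1 : ∀ x ∈ S, (0 : ℝ) ≤ if D x w then (1 : ℝ) else 0 := fun x _ => by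
      split_ifs <;> norm_num
    have nn2 : ∀ p ∈ S.offDiag, (0 : ℝ) ≤ if B p w then (1 : ℝ) else 0 := fun x _ => by
      split_ifs <;> norm_num
    by_cases hd : ∃ z ∈ S, D z w
    · obtain ⟨z, hz, hdz⟩ := hd
      have := Finset.single_le_sum nn1 hz
      rw [if_pos hdz] at this
      linarith [Finset.sum_nonneg nn2]
    · push Not at hd
      obtain ⟨x, hx, y, hy, hxy⟩ := hcon w
      have dx := not_lt.mp (hd x hx)
      have dy := not_lt.mp (hd y hy)
      have hne : x ≠ y := by
        rintro rfl
        have : (k : ℝ) * (t * ε) ≤ k * ε := by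
          gcongr
          nlinarith
        linarith
      have hsub : ({(x, y), (y, x)} : Finset _) ⊆ S.offDiag := by
        intro p hp
        simp only [Finset.mem_insert, Finset.mem_singleton] at hp
        rcases hp with rfl | rfl
        · exact Finset.mem_offDiag.mpr ⟨hx, hy, hne⟩
        · exact Finset.mem_offDiag.mpr ⟨hy, hx, hne.symm⟩
      have := Finset.sum_le_sum_of_subset_of_nonneg hsub (fun p hp _ => nn2 p hp)
      rw [Finset.sum_pair (by simp [hne]), if_pos ⟨hxy, dx, dy⟩,
        if_pos ⟨by rwa [gramError_comm], dy, dx⟩] at this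
      linarith [Finset.sum_nonneg nn1]
  have hE : (1 : ℝ) ≤ ∑ x ∈ S, uniformProb (D x) + 1 / 2 * ∑ p ∈ S.offDiag, uniformProb (B p) := by
    have := expect_mono hΦ
    rw [Fintype.expect_const, Finset.expect_add_distrib, ← Finset.mul_expect,
      Finset.expect_sum_comm, Finset.expect_sum_comm] at this
    simp only [uniformProb]
    convert this
  have b1 : ∑ x ∈ S, uniformProb (D x) ≤ S.card * τ₁ := by
    rw [← nsmul_eq_mul]
    exact Finset.sum_le_card_nsmul _ _ _ fun x hx => h1.gramError_self x (hunit x hx)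
  have b2 : ∑ p ∈ S.offDiag, uniformProb (B p) ≤ (S.card * S.card - S.card) * τ₂ := by
    have hc : ((S.offDiag.card : ℕ) : ℝ) = S.card * S.card - S.card := by
      rw [Finset.offDiag_card, Nat.cast_sub (Nat.le_mul_self _), Nat.cast_mul]
    rw [← hc, ← nsmul_eq_mul]
    refine Finset.sum_le_card_nsmul _ _ _ fun p hp => ?_
    obtain ⟨hp1, hp2, -⟩ := Finset.mem_offDiag.mp hp
    exact h2.gramError_pair (by linarith) hg2 p.1 p.2 (hunit _ hp1) (hunit _ hp2)
  have hc : (S.card : ℝ) ≤ n := by exact_mod_cast hcard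
  rcases Nat.eq_zero_or_pos S.card with h0 | h0
  · rw [h0] at b1 b2
    norm_num at b1 b2
    linarith
  · have h0' : (1 : ℝ) ≤ S.card := by exact_mod_cast h0
    have : ((S.card : ℝ) * S.card - S.card) ≤ n * (n - 1) := by nlinarith
    have c1 := mul_le_mul_of_nonneg_right hc hτ₁
    have c2 := mul_le_mul_of_nonneg_right this hτ₂
    linarith

lemma expect_gramError_sq_le {d k : ℕ} (x y : Fin d → ℝ) :
    𝔼 w : Fin k → Fin d → Bool, gramError x y w ^ 2 ≤
      k * ((x ⬝ᵥ x) * (y ⬝ᵥ y) + (x ⬝ᵥ y) ^ 2) := by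
  have hmean : 𝔼 s, (rademacherSum x s * rademacherSum y s - x ⬝ᵥ y) = 0 := by
    rw [Finset.expect_sub_distrib, expect_rademacherSum_mul, Fintype.expect_const, sub_self]
  simp only [gramError]
  rw [expect_rowSum_sq hmean]
  have h : ∀ s, (rademacherSum x s * rademacherSum y s - x ⬝ᵥ y) ^ 2 =
      rademacherSum x s * rademacherSum y s * (rademacherSum x s * rademacherSum y s) -
        2 * (x ⬝ᵥ y) * (rademacherSum x s * rademacherSum y s) + (x ⬝ᵥ y) ^ 2 := by
    intro s; ring
  have hs : 0 ≤ ∑ i, x i * y i * x i * y i := Finset.sum_nonneg fun i _ => by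
    nlinarith [sq_nonneg (x i * y i)]
  simp only [h, Finset.expect_add_distrib, Finset.expect_sub_distrib, ← Finset.mul_expect,
    expect_rademacherSum_mul_four, expect_rademacherSum_mul, Fintype.expect_const]
  gcongr
  rw [dotProduct_comm y x]
  nlinarith

lemma exists_lt_of_expect_lt {Ω : Type*} [Fintype Ω] [Nonempty Ω] {f : Ω → ℝ} {c : ℝ}
    (h : 𝔼 w, f w < c) : ∃ w, f w < c := by
  by_contra! hcon
  have := expect_mono hcon
  rw [Fintype.expect_const] at this
  linarith

lemma exists_gramError_pair_le_of_nonneg {d k : ℕ} {ε : ℝ} (hε : 0 < ε) (hk : 0 < k)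
    (hkε : 8 * Real.log 2 ≤ k * ε ^ 2) (x y : Fin d → ℝ) (hx : x ⬝ᵥ x = 1) (hy : y ⬝ᵥ y = 1)
    (hxy : 0 ≤ x ⬝ᵥ y) :
    ∃ w : Fin k → Fin d → Bool, |gramError x x w| ≤ k * ε ∧ |gramError y y w| ≤ k * ε ∧
      |gramError x y w| ≤ k * ε := by
  have hk' : (0 : ℝ) < k := by exact_mod_cast hk
  have hlog := Real.log_two_gt_d9
  have hkk : 5.5 * (k : ℝ) < (k * ε) ^ 2 := by nlinarith
  have hkε0 : 0 ≤ k * ε := by positivity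
  have hle : x ⬝ᵥ y ≤ 1 := by
    have : 0 ≤ (x - y) ⬝ᵥ (x - y) := Finset.sum_nonneg fun i _ => mul_self_nonneg _
    rw [dotProduct_sub_self, hx, hy] at this
    linarith
  rcases le_total (x ⬝ᵥ y) 0.7 with hρ | hρ
  · have hE : 𝔼 w : Fin k → Fin d → Bool,
        (gramError x x w ^ 2 + gramError y y w ^ 2 + gramError x y w ^ 2) < (k * ε) ^ 2 := by
      rw [Finset.expect_add_distrib, Finset.expect_add_distrib]
      have h1 := expect_gramError_sq_le (k := k) x x
      have h2 := expect_gramError_sq_le (k := k) y y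
      have h3 := expect_gramError_sq_le (k := k) x y
      rw [hx] at h1
      rw [hy] at h2
      rw [hx, hy] at h3
      have : (x ⬝ᵥ y) ^ 2 ≤ 0.5 := by nlinarith
      nlinarith
    obtain ⟨w, hw⟩ := exists_lt_of_expect_lt hE
    refine ⟨w, ?_, ?_, ?_⟩ <;> refine abs_le_of_sq_le_sq ?_ hkε0 <;>
      nlinarith [sq_nonneg (gramError x x w), sq_nonneg (gramError y y w),
        sq_nonneg (gramError x y w)]
  · have hA := expect_gramError_sq_le (k := k) (x + y) (x + y)
    have hB := expect_gramError_sq_le (k := k) (x - y) (x - y)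
    have hC := expect_gramError_sq_le (k := k) (x + y) (x - y)
    rw [dotProduct_add_self, hx, hy] at hA
    rw [dotProduct_sub_self, hx, hy] at hB
    rw [dotProduct_add_sub, dotProduct_add_self, dotProduct_sub_self, hx, hy] at hC
    have hE : 𝔼 w : Fin k → Fin d → Bool, (gramError (x + y) (x + y) w ^ 2 +
        5 * gramError (x - y) (x - y) w ^ 2 + 8 * gramError (x + y) (x - y) w ^ 2) <
          16 / 1.7 * (k * ε) ^ 2 := by
      rw [Finset.expect_add_distrib, Finset.expect_add_distrib, ← Finset.mul_expect,
        ← Finset.mul_expect]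
      set ρ := x ⬝ᵥ y
      have : 2 * (1 + 2 * ρ + 1) ^ 2 + 10 * (1 - 2 * ρ + 1) ^ 2 +
          8 * (1 + 2 * ρ + 1) * (1 - 2 * ρ + 1) ≤ 50 := by nlinarith
      nlinarith
    obtain ⟨w, hw⟩ := exists_lt_of_expect_lt hE
    set A := gramError (x + y) (x + y) w
    set B := gramError (x - y) (x - y) w
    set C := gramError (x + y) (x - y) w
    have e1 : gramError x x w = (A + 2 * C + B) / 4 := by
      simp only [A, B, C, gramError, rowSum, Finset.mul_sum, ← Finset.sum_add_distrib,
        Finset.sum_div, rademacherSum_add, rademacherSum_sub, dotProduct_add_self,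
        dotProduct_sub_self, dotProduct_add_sub]
      refine Finset.sum_congr rfl fun i _ => ?_
      ring
    have e2 : gramError y y w = (A - 2 * C + B) / 4 := by
      simp only [A, B, C, gramError, rowSum, Finset.mul_sum, ← Finset.sum_add_distrib,
        ← Finset.sum_sub_distrib, Finset.sum_div, rademacherSum_add, rademacherSum_sub,
        dotProduct_add_self, dotProduct_sub_self, dotProduct_add_sub]
      refine Finset.sum_congr rfl fun i _ => ?_
      ring
    have e3 : gramError x y w = (A - B) / 4 := by
      simp only [A, B, gramError, rowSum, ← Finset.sum_sub_distrib, Finset.sum_div,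
        rademacherSum_add, rademacherSum_sub, dotProduct_add_self, dotProduct_sub_self]
      refine Finset.sum_congr rfl fun i _ => ?_
      ring
    have hCS : ∀ c b : ℝ, (A + c + b) ^ 2 ≤ 1.7 * (A ^ 2 + 5 * b ^ 2 + 2 * c ^ 2) := by
      intro c b
      nlinarith [sq_nonneg (A - 5 * b), sq_nonneg (A - 2 * c), sq_nonneg (2 * c - 5 * b)]
    refine ⟨w, ?_, ?_, ?_⟩ <;> refine abs_le_of_sq_le_sq ?_ hkε0
    · rw [e1]
      linarith [hCS (2 * C) B]
    · rw [e2]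
      linarith [hCS (-(2 * C)) B]
    · rw [e3]
      linarith [hCS 0 (-B), sq_nonneg C]

lemma exists_gramError_pair_le {d k : ℕ} {ε : ℝ} (hε : 0 < ε) (hk : 0 < k)
    (hkε : 8 * Real.log 2 ≤ k * ε ^ 2) (x y : Fin d → ℝ) (hx : x ⬝ᵥ x = 1) (hy : y ⬝ᵥ y = 1) :
    ∃ w : Fin k → Fin d → Bool, |gramError x x w| ≤ k * ε ∧ |gramError y y w| ≤ k * ε ∧
      |gramError x y w| ≤ k * ε := by
  rcases le_total 0 (x ⬝ᵥ y) with hxy | hxy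
  · exact exists_gramError_pair_le_of_nonneg hε hk hkε x y hx hy hxy
  · have := exists_gramError_pair_le_of_nonneg hε hk hkε x (-y) hx (by simpa using hy)
      (by simpa using hxy)
    simp only [gramError_neg_neg] at this
    simpa only [gramError_neg_right, abs_neg] using this

lemma exists_gramError_le_of_card_le_two {d k : ℕ} {ε : ℝ} (hε : 0 < ε) (hk : 0 < k)
    (hkε : 8 * Real.log 2 ≤ k * ε ^ 2) (S : Finset (Fin d → ℝ)) (hcard : S.card ≤ 2)
    (hunit : ∀ x ∈ S, x ⬝ᵥ x = 1) :
    ∃ w : Fin k → Fin d → Bool, ∀ x ∈ S, ∀ y ∈ S, |gramError x y w| ≤ k * ε := by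
  classical
  rcases S.eq_empty_or_nonempty with rfl | ⟨x, hx⟩
  · exact ⟨fun _ _ => true, by simp⟩
  · obtain ⟨y, hy, hS⟩ : ∃ y ∈ S, ∀ z ∈ S, z = x ∨ z = y := by
      by_cases h : ∃ y ∈ S, y ≠ x
      · obtain ⟨y, hy, hyx⟩ := h
        refine ⟨y, hy, fun z hz => ?_⟩
        by_contra! hz'
        have hsub : ({x, y, z} : Finset _) ⊆ S := by
          intro p hp
          simp only [Finset.mem_insert, Finset.mem_singleton] at hp
          rcases hp with rfl | rfl | rfl <;> assumption
        have := Finset.card_le_card hsub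
        rw [Finset.card_eq_three.mpr ⟨x, y, z, hyx.symm, hz'.1.symm, hz'.2.symm, rfl⟩] at this
        omega
      · push Not at h
        exact ⟨x, hx, fun z hz => Or.inl (h z hz)⟩
    obtain ⟨w, h1, h2, h3⟩ := exists_gramError_pair_le hε hk hkε x y (hunit x hx) (hunit y hy)
    refine ⟨w, fun a ha b hb => ?_⟩
    rcases hS a ha with rfl | rfl <;> rcases hS b hb with rfl | rfl
    · exact h1
    · exact h3
    · rwa [gramError_comm]
    · exact h2

lemma le_log_of_two_pow_le {n p q : ℕ} {l : ℝ} (hq : 0 < q) (h : 2 ^ p ≤ n ^ q)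
    (hl : q * l ≤ p * 0.6931) : l ≤ Real.log n := by
  have h' : ((2 : ℝ) ^ p) ≤ (n : ℝ) ^ q := by exact_mod_cast h
  have h2 := Real.log_le_log (by positivity) h'
  rw [Real.log_pow, Real.log_pow] at h2
  have h3 := Real.log_two_gt_d9
  have hq' : (0 : ℝ) < q := by exact_mod_cast hq
  have hp : (p : ℝ) * 0.6931 ≤ p * Real.log 2 := by
    gcongr
    linarith
  exact le_of_mul_le_mul_left (by linarith) hq'

section LogRanges

variable {d k n : ℕ} {ε : ℝ} (hε : 0 < ε) (hkε : 8 * Real.log n ≤ k * ε ^ 2)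
  (S : Finset (Fin d → ℝ)) (hcard : S.card ≤ n) (hunit : ∀ x ∈ S, x ⬝ᵥ x = 1)

include hε hkε hcard hunit

lemma exists_gramError_le_of_eq_three (hn : n = 3) (hk : 562 ≤ k) :
    ∃ w : Fin k → Fin d → Bool, ∀ x ∈ S, ∀ y ∈ S, |gramError x y w| ≤ k * ε := by
  subst hn
  have hk' : (562 : ℝ) ≤ k := by exact_mod_cast hk
  have hk0 : (0 : ℝ) < k := by linarith
  have ht := signFormTail_four d (k := k) (by omega) hε
  have hτ : (12 + 200 / k) / (k ^ 2 * ε ^ 4) < (1 / 6 : ℝ) := by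
    rw [div_lt_iff₀ (by positivity)]
    have h1 : (200 : ℝ) / k ≤ 200 / 562 := by gcongr
    have hl := Real.log_three_gt_d9
    have h2 : (8.788 : ℝ) ≤ k * ε ^ 2 := by
      push_cast at hkε
      linarith
    have h3 : (8.788 : ℝ) ^ 2 ≤ (k * ε ^ 2) ^ 2 := by gcongr
    have e : (k : ℝ) ^ 2 * ε ^ 4 = (k * ε ^ 2) ^ 2 := by ring
    rw [e]
    norm_num at h1 h3 ⊢
    linarith
  refine exists_gramError_le_of_tails (t := 1) (n := 3) S hcard hunit hε.le le_rfl (by norm_num)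
    (by rwa [one_mul]) (by norm_num; exact ht) (by positivity) (by positivity) ?_
  norm_num at hτ ⊢
  linarith

lemma exists_gramError_le_of_pow_six {N : ℕ} {l : ℝ} (hn : 1 ≤ n) (hnN : n ≤ N) (hl0 : 0 < l)
    (hl : l ≤ Real.log n) (hk : 709 ≤ k)
    (hN : 135 * ((N : ℝ) / 0.92 ^ 6 + N * (N - 1) / 2 / 1.12 ^ 6) < 512 * l ^ 3) :
    ∃ w : Fin k → Fin d → Bool, ∀ x ∈ S, ∀ y ∈ S, |gramError x y w| ≤ k * ε := by
  have hk0 : (0 : ℝ) < k := by exact_mod_cast (by omega : 0 < k)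
  have hn' : (1 : ℝ) ≤ n := by exact_mod_cast hn
  have hnN' : (n : ℝ) ≤ N := by exact_mod_cast hnN
  have h1 : (8 * l) ^ 3 ≤ (k * ε ^ 2) ^ 3 :=
    pow_le_pow_left₀ (by positivity) (by linarith) _
  have hp : 0 < (k * ε ^ 2) ^ 3 := by positivity
  refine exists_gramError_le_of_tails (t := 0.92) S hcard hunit hε.le (by norm_num) (by norm_num)
    (signFormTail_six d hk (by positivity)) (signFormTail_six d hk (by norm_num; positivity))
    (by positivity) (by norm_num; positivity) ?_
  have e1 : ∀ c : ℝ, 135 / (k ^ 3 * (c * ε) ^ 6) = 135 / c ^ 6 / (k * ε ^ 2) ^ 3 := fun c => by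
    rw [div_div]; congr 1; ring
  have e2 : ∀ a b x y P : ℝ, a * (x / P) + b * (y / P) = (a * x + b * y) / P :=
    fun a b x y P => by ring
  rw [e1, e1, e2, div_lt_one hp]
  have h2 : (n : ℝ) * (n - 1) ≤ N * (N - 1) := by nlinarith
  norm_num at hN h1 ⊢
  linarith

lemma exists_gramError_le_of_pow_eight {N : ℕ} {l : ℝ} (hn : 1 ≤ n) (hnN : n ≤ N) (hl0 : 0 < l)
    (hl : l ≤ Real.log n) (hk : 1178 ≤ k)
    (hN : 2100 * ((N : ℝ) / 0.92 ^ 8 + N * (N - 1) / 2 / 1.12 ^ 8) < 4096 * l ^ 4) :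
    ∃ w : Fin k → Fin d → Bool, ∀ x ∈ S, ∀ y ∈ S, |gramError x y w| ≤ k * ε := by
  have hk0 : (0 : ℝ) < k := by exact_mod_cast (by omega : 0 < k)
  have hn' : (1 : ℝ) ≤ n := by exact_mod_cast hn
  have hnN' : (n : ℝ) ≤ N := by exact_mod_cast hnN
  have h1 : (8 * l) ^ 4 ≤ (k * ε ^ 2) ^ 4 :=
    pow_le_pow_left₀ (by positivity) (by linarith) _
  have hp : 0 < (k * ε ^ 2) ^ 4 := by positivity
  refine exists_gramError_le_of_tails (t := 0.92) S hcard hunit hε.le (by norm_num) (by norm_num)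
    (signFormTail_eight d hk (by positivity)) (signFormTail_eight d hk (by norm_num; positivity))
    (by positivity) (by norm_num; positivity) ?_
  have e1 : ∀ c : ℝ, 2100 / (k ^ 4 * (c * ε) ^ 8) = 2100 / c ^ 8 / (k * ε ^ 2) ^ 4 := fun c => by
    rw [div_div]; congr 1; ring
  have e2 : ∀ a b x y P : ℝ, a * (x / P) + b * (y / P) = (a * x + b * y) / P :=
    fun a b x y P => by ring
  rw [e1, e1, e2, div_lt_one hp]
  have h2 : (n : ℝ) * (n - 1) ≤ N * (N - 1) := by nlinarith
  norm_num at hN h1 ⊢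
  linarith

lemma exists_gramError_le_of_ge (hn : 32 ≤ n) (hε1 : ε ≤ 1 / 8) :
    ∃ w : Fin k → Fin d → Bool, ∀ x ∈ S, ∀ y ∈ S, |gramError x y w| ≤ k * ε := by
  have hn0 : (0 : ℝ) < n := by exact_mod_cast (by omega : 0 < n)
  have hL : 5 * Real.log 2 ≤ Real.log n := by
    have : Real.log ((2 : ℝ) ^ 5) ≤ Real.log n :=
      Real.log_le_log (by positivity) (by norm_num; exact_mod_cast hn)
    rw [Real.log_pow] at this
    exact_mod_cast this
  have hlog2 := Real.log_two_gt_d9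
  set L := Real.log n with hLdef
  have hnL : (n : ℝ) = Real.exp L := (Real.exp_log hn0).symm
  have h1 := signFormTail_exp d k (t := 0.92 * ε) (by positivity) (by linarith)
  have h2 := signFormTail_exp d k (t := (5 / 2 - 3 / 2 * 0.92) * ε)
    (by norm_num; positivity) (by norm_num; linarith)
  have t1 : Real.exp (-(k * (0.92 * ε) ^ 2 * (1 - 0.92 * ε) / 4)) ≤ Real.exp (-(1.498 * L)) := by
    apply Real.exp_le_exp.mpr
    have : 8 * L * 0.885 ≤ k * ε ^ 2 * (1 - 0.92 * ε) := by
      apply mul_le_mul hkε (by linarith) (by norm_num) (by positivity)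
    nlinarith
  have t2 : Real.exp (-(k * ((5 / 2 - 3 / 2 * 0.92) * ε) ^ 2 *
      (1 - (5 / 2 - 3 / 2 * 0.92) * ε) / 4)) ≤ Real.exp (-(2.1575 * L)) := by
    apply Real.exp_le_exp.mpr
    norm_num
    have : 8 * L * 0.86 ≤ k * ε ^ 2 * (1 - 28 / 25 * ε) := by
      apply mul_le_mul hkε (by linarith) (by norm_num) (by positivity)
    nlinarith
  have p1 : Real.exp (-(0.498 * L)) ≤ 0.19 := by
    apply le_of_pow_le_pow_left₀ (n := 5) (by norm_num) (by norm_num)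
    rw [← Real.exp_nat_mul]
    calc _ ≤ Real.exp (-(12 : ℕ) * Real.log 2) := by
          apply Real.exp_le_exp.mpr
          push_cast
          linarith
      _ = (2 ^ 12)⁻¹ := by
          rw [neg_mul, Real.exp_neg, Real.exp_nat_mul, Real.exp_log (by norm_num)]
      _ ≤ _ := by norm_num
  have p2 : Real.exp (-(0.1575 * L)) ≤ 0.595 := by
    apply le_of_pow_le_pow_left₀ (n := 4) (by norm_num) (by norm_num)
    rw [← Real.exp_nat_mul]
    calc _ ≤ Real.exp (-(3 : ℕ) * Real.log 2) := by
          apply Real.exp_le_exp.mpr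
          push_cast
          linarith
      _ = (2 ^ 3)⁻¹ := by
          rw [neg_mul, Real.exp_neg, Real.exp_nat_mul, Real.exp_log (by norm_num)]
      _ ≤ _ := by norm_num
  refine exists_gramError_le_of_tails (t := 0.92) S hcard hunit hε.le (by norm_num) (by norm_num)
    (h1.mono le_rfl (mul_le_mul_of_nonneg_left t1 (by norm_num)))
    (h2.mono le_rfl (mul_le_mul_of_nonneg_left t2 (by norm_num)))
    (by positivity) (by positivity) ?_
  have s1 : (n : ℝ) * (2 * Real.exp (-(1.498 * L))) = 2 * Real.exp (-(0.498 * L)) := by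
    rw [hnL, mul_left_comm, ← Real.exp_add]
    ring_nf
  have s2 : (n : ℝ) * (n - 1) / 2 * (2 * Real.exp (-(2.1575 * L))) ≤
      Real.exp (-(0.1575 * L)) := by
    calc _ ≤ (n : ℝ) * n / 2 * (2 * Real.exp (-(2.1575 * L))) := by
          gcongr
          linarith
      _ = Real.exp L * Real.exp L * Real.exp (-(2.1575 * L)) := by rw [← hnL]; ring
      _ = _ := by
          rw [← Real.exp_add, ← Real.exp_add]
          ring_nf
  linarith

lemma exists_gramError_le_of_unit (hn : 2 ≤ n) (hε1 : ε ≤ 1 / 8)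
    (hk : 512 * Real.log n ≤ k) :
    ∃ w : Fin k → Fin d → Bool, ∀ x ∈ S, ∀ y ∈ S, |gramError x y w| ≤ k * ε := by
  have hkl : ∀ (l : ℝ) (K : ℕ), l ≤ Real.log n → (K : ℝ) ≤ 512 * l → K ≤ k := by
    intro l K hl hK
    have : (K : ℝ) ≤ k := by linarith
    exact_mod_cast this
  have six : ∀ (N p q : ℕ) (l : ℝ), n ≤ N → 4 ≤ n → 0 < q → 2 ^ p ≤ n ^ q →
      q * l = p * 0.6931 →
      135 * ((N : ℝ) / 0.92 ^ 6 + N * (N - 1) / 2 / 1.12 ^ 6) < 512 * l ^ 3 →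
      ∃ w : Fin k → Fin d → Bool, ∀ x ∈ S, ∀ y ∈ S, |gramError x y w| ≤ k * ε := by
    intro N p q l hnN hn4 hq hpq hl hN
    have hl0 : 0 < l := by
      by_contra! hl0
      have : l ^ 3 ≤ 0 := by nlinarith [sq_nonneg l]
      have hN1 : (4 : ℝ) ≤ N := by exact_mod_cast hn4.trans hnN
      have : 0 ≤ 135 * ((N : ℝ) / 0.92 ^ 6 + N * (N - 1) / 2 / 1.12 ^ 6) := by
        have : (0 : ℝ) ≤ N - 1 := by linarith
        positivity
      linarith
    have h4 : (1.386 : ℝ) ≤ Real.log n := le_log_of_two_pow_le (p := 2) (q := 1) one_pos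
      (by simpa using hn4) (by norm_num)
    exact exists_gramError_le_of_pow_six hε hkε S hcard hunit (by omega) hnN hl0
      (le_log_of_two_pow_le hq hpq hl.le) (hkl 1.386 709 h4 (by norm_num)) hN
  have eight : ∀ (N p q : ℕ) (l : ℝ), n ≤ N → 10 ≤ n → 0 < q → 2 ^ p ≤ n ^ q →
      q * l = p * 0.6931 → 0 < l →
      2100 * ((N : ℝ) / 0.92 ^ 8 + N * (N - 1) / 2 / 1.12 ^ 8) < 4096 * l ^ 4 →
      ∃ w : Fin k → Fin d → Bool, ∀ x ∈ S, ∀ y ∈ S, |gramError x y w| ≤ k * ε := by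
    intro N p q l hnN hn10 hq hpq hl hl0 hN
    have h10 : (2.301 : ℝ) ≤ Real.log n := by
      have h1 : Real.log (10 : ℝ) ≤ Real.log n :=
        Real.log_le_log (by norm_num) (by exact_mod_cast hn10)
      rw [Real.log_ten_eq] at h1
      linarith [Real.log_two_gt_d9, Real.log_five_gt_d9]
    exact exists_gramError_le_of_pow_eight hε hkε S hcard hunit (by omega) hnN hl0
      (le_log_of_two_pow_le hq hpq hl.le) (hkl 2.301 1178 h10 (by norm_num)) hN
  have hpow : ∀ (c p q : ℕ), 2 ^ p ≤ c ^ q → c ≤ n → 2 ^ p ≤ n ^ q := fun c p q h hc =>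
    h.trans (Nat.pow_le_pow_left hc q)
  rcases le_or_gt 32 n with h32 | h32
  · exact exists_gramError_le_of_ge hε hkε S hcard hunit h32 hε1
  rcases le_or_gt 30 n with h30 | h30
  · exact eight 31 49 10 (4.9 * 0.6931) (by omega) (by omega) (by norm_num)
      (hpow 30 _ _ (by norm_num) h30) (by norm_num) (by norm_num) (by norm_num)
  rcases le_or_gt 27 n with h27 | h27
  · exact eight 29 95 20 (4.75 * 0.6931) (by omega) (by omega) (by norm_num)
      (hpow 27 _ _ (by norm_num) h27) (by norm_num) (by norm_num) (by norm_num)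
  rcases le_or_gt 24 n with h24 | h24
  · exact eight 26 45 10 (4.5 * 0.6931) (by omega) (by omega) (by norm_num)
      (hpow 24 _ _ (by norm_num) h24) (by norm_num) (by norm_num) (by norm_num)
  rcases le_or_gt 20 n with h20 | h20
  · exact eight 23 43 10 (4.3 * 0.6931) (by omega) (by omega) (by norm_num)
      (hpow 20 _ _ (by norm_num) h20) (by norm_num) (by norm_num) (by norm_num)
  rcases le_or_gt 16 n with h16 | h16
  · exact eight 19 4 1 (4 * 0.6931) (by omega) (by omega) (by norm_num)
      (hpow 16 _ _ (by norm_num) h16) (by norm_num) (by norm_num) (by norm_num)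
  rcases le_or_gt 13 n with h13 | h13
  · exact eight 15 37 10 (3.7 * 0.6931) (by omega) (by omega) (by norm_num)
      (hpow 13 _ _ (by norm_num) h13) (by norm_num) (by norm_num) (by norm_num)
  rcases le_or_gt 10 n with h10 | h10
  · exact eight 12 33 10 (3.3 * 0.6931) (by omega) (by omega) (by norm_num)
      (hpow 10 _ _ (by norm_num) h10) (by norm_num) (by norm_num) (by norm_num)
  rcases le_or_gt 8 n with h8 | h8
  · exact six 9 3 1 (3 * 0.6931) (by omega) (by omega) (by norm_num)
      (hpow 8 _ _ (by norm_num) h8) (by norm_num) (by norm_num)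
  rcases le_or_gt 7 n with h7 | h7
  · exact six 7 11 4 (2.75 * 0.6931) (by omega) (by omega) (by norm_num)
      (hpow 7 _ _ (by norm_num) h7) (by norm_num) (by norm_num)
  rcases le_or_gt 6 n with h6 | h6
  · exact six 6 5 2 (2.5 * 0.6931) (by omega) (by omega) (by norm_num)
      (hpow 6 _ _ (by norm_num) h6) (by norm_num) (by norm_num)
  rcases le_or_gt 5 n with h5 | h5
  · exact six 5 9 4 (2.25 * 0.6931) (by omega) (by omega) (by norm_num)
      (hpow 5 _ _ (by norm_num) h5) (by norm_num) (by norm_num)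
  rcases le_or_gt 4 n with h4 | h4
  · exact six 4 2 1 (2 * 0.6931) (by omega) (by omega) (by norm_num)
      (hpow 4 _ _ (by norm_num) h4) (by norm_num) (by norm_num)
  rcases le_or_gt 3 n with h3 | h3
  · have hn3 : n = 3 := by omega
    refine exists_gramError_le_of_eq_three hε hkε S hcard hunit hn3
      (hkl 1.0986 562 ?_ (by norm_num))
    rw [hn3]
    push_cast
    linarith [Real.log_three_gt_d9]
  · have hn2 : n = 2 := by omega
    subst hn2
    refine exists_gramError_le_of_card_le_two hε
      (hkl 0.6931 1 ?_ (by norm_num)) (by exact_mod_cast hkε) S hcard hunit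
    push_cast
    linarith [Real.log_two_gt_d9]

end LogRanges

lemma gramError_smul_smul {d k : ℕ} (a b : ℝ) (x y : Fin d → ℝ) (w : Fin k → Fin d → Bool) :
    gramError (a • x) (b • y) w = a * b * gramError x y w := by
  simp only [gramError, rowSum, rademacherSum_smul, smul_dotProduct, dotProduct_smul,
    smul_eq_mul, Finset.mul_sum]
  refine Finset.sum_congr rfl fun i _ => ?_
  ring

lemma exists_gramError_le {d k n : ℕ} {ε : ℝ} (hn : 2 ≤ n) (hε : 0 < ε) (hε1 : ε ≤ 1 / 8)
    (hkε : 8 * Real.log n ≤ k * ε ^ 2) (hk : 512 * Real.log n ≤ k) (S : Finset (Fin d → ℝ))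
    (hcard : S.card ≤ n) (hnorm : ∀ x ∈ S, x ⬝ᵥ x ≤ 1) :
    ∃ w : Fin k → Fin d → Bool, ∀ x ∈ S, ∀ y ∈ S, |gramError x y w| ≤ k * ε := by
  classical
  have nn : ∀ x : Fin d → ℝ, 0 ≤ x ⬝ᵥ x := fun x =>
    Finset.sum_nonneg fun i _ => mul_self_nonneg _
  set N : (Fin d → ℝ) → (Fin d → ℝ) := fun x => (Real.sqrt (x ⬝ᵥ x))⁻¹ • x with hN
  have hunit : ∀ z ∈ (S.filter (· ≠ 0)).image N, z ⬝ᵥ z = 1 := by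
    intro z hz
    obtain ⟨x, hx, rfl⟩ := Finset.mem_image.mp hz
    have hx0 : x ⬝ᵥ x ≠ 0 := fun h => (Finset.mem_filter.mp hx).2 (dotProduct_self_eq_zero.mp h)
    simp only [hN, smul_dotProduct, dotProduct_smul, smul_eq_mul]
    rw [← mul_assoc, ← mul_inv, Real.mul_self_sqrt (nn x), inv_mul_cancel₀ hx0]
  obtain ⟨w, hw⟩ := exists_gramError_le_of_unit hε hkε ((S.filter (· ≠ 0)).image N)
    (Finset.card_image_le.trans ((Finset.card_filter_le _ _).trans hcard)) hunit hn hε1 hk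
  have hsmul : ∀ x ∈ S, x ≠ 0 → x = Real.sqrt (x ⬝ᵥ x) • N x := by
    intro x _ hx
    have : Real.sqrt (x ⬝ᵥ x) ≠ 0 := by
      rw [Real.sqrt_ne_zero (nn x)]
      exact fun h => hx (dotProduct_self_eq_zero.mp h)
    rw [hN, smul_smul, mul_inv_cancel₀ this, one_smul]
  have hsqrt : ∀ x ∈ S, Real.sqrt (x ⬝ᵥ x) ≤ 1 := fun x hx => Real.sqrt_le_one.mpr (hnorm x hx)
  refine ⟨w, fun x hx y hy => ?_⟩
  have h0 : (0 : ℝ) ≤ k * ε := by positivity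
  by_cases hx0 : x = 0
  · simpa [hx0, gramError, rowSum, rademacherSum_zero] using h0
  by_cases hy0 : y = 0
  · simpa [hy0, gramError, rowSum, rademacherSum_zero] using h0
  have hxy := hw (N x) (Finset.mem_image_of_mem _ (Finset.mem_filter.mpr ⟨hx, hx0⟩)) (N y)
    (Finset.mem_image_of_mem _ (Finset.mem_filter.mpr ⟨hy, hy0⟩))
  have hxs := Real.sqrt_nonneg (x ⬝ᵥ x)
  have hys := Real.sqrt_nonneg (y ⬝ᵥ y)
  have e : gramError x y w =
      Real.sqrt (x ⬝ᵥ x) * Real.sqrt (y ⬝ᵥ y) * gramError (N x) (N y) w := by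
    rw [← gramError_smul_smul, ← hsmul x hx hx0, ← hsmul y hy hy0]
  rw [e, abs_mul, abs_of_nonneg (mul_nonneg hxs hys)]
  calc _ ≤ 1 * |gramError (N x) (N y) w| := by
        gcongr
        exact mul_le_one₀ (hsqrt x hx) hys (hsqrt y hy)
    _ ≤ _ := by rwa [one_mul]

lemma signMatrix_mulVec_dotProduct_sub {d k : ℕ} (hk : 0 < k) (w : Fin k → Fin d → Bool)
    (x y : Fin d → ℝ) :
    let R : Matrix (Fin k) (Fin d) ℝ :=
      Matrix.of fun i j => if w i j then 1 / Real.sqrt k else -(1 / Real.sqrt k)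
    (R.mulVec x) ⬝ᵥ (R.mulVec y) - x ⬝ᵥ y = gramError x y w / k := by
  intro R
  have hk0 : (0 : ℝ) < k := by exact_mod_cast hk
  have hR : ∀ (z : Fin d → ℝ) (i : Fin k),
      R.mulVec z i = rademacherSum z (w i) / Real.sqrt k := by
    intro z i
    simp only [R, Matrix.mulVec, dotProduct, Matrix.of_apply, rademacherSum, Finset.sum_div]
    refine Finset.sum_congr rfl fun j _ => ?_
    split_ifs <;> ring
  have h1 : (R.mulVec x) ⬝ᵥ (R.mulVec y) =
      (∑ i, rademacherSum x (w i) * rademacherSum y (w i)) / k := by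
    rw [dotProduct, Finset.sum_div]
    refine Finset.sum_congr rfl fun i _ => ?_
    rw [hR, hR, div_mul_div_comm, Real.mul_self_sqrt hk0.le]
  rw [h1, gramError, rowSum, Finset.sum_sub_distrib, Finset.sum_const, Finset.card_univ,
    Fintype.card_fin, nsmul_eq_mul]
  field_simp

/-- Johnson–Lindenstrauss type embedding with `±1/√k` entries preserving inner products:
for any set `S` of `n ≥ 2` points of the unit ball of `ℝ^d` and any integer `m ≥ 1`,
there are `k ≤ 512 m⁴ log n + 1` and a sign matrix `R ∈ ℝ^{k×d}` (entries `±1/√k`)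
with `|(Rx)ᵀ(Ry) − xᵀy| ≤ 1/(8m²)` for all `x, y ∈ S`. -/
theorem jl_inner_product_embedding {d n m : ℕ} (hn : 2 ≤ n) (hm : 1 ≤ m)
    (S : Finset (Fin d → ℝ)) (hcard : S.card = n)
    (hnorm : ∀ x ∈ S, x ⬝ᵥ x ≤ 1) :
    ∃ (k : ℕ) (R : Matrix (Fin k) (Fin d) ℝ),
      (k : ℝ) ≤ 512 * (m : ℝ) ^ 4 * Real.log n + 1 ∧
      (∀ i j, R i j = 1 / Real.sqrt k ∨ R i j = -(1 / Real.sqrt k)) ∧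
      ∀ x ∈ S, ∀ y ∈ S,
        |(R.mulVec x) ⬝ᵥ (R.mulVec y) - x ⬝ᵥ y| ≤ 1 / (8 * (m : ℝ) ^ 2) := by
  have hm' : (1 : ℝ) ≤ m := by exact_mod_cast hm
  have hn' : (2 : ℝ) ≤ n := by exact_mod_cast hn
  have hlog : 0 < Real.log n := Real.log_pos (by linarith)
  have hm4 : (1 : ℝ) ≤ (m : ℝ) ^ 4 := one_le_pow₀ hm'
  set k := ⌊512 * (m : ℝ) ^ 4 * Real.log n + 1⌋₊ with hk
  have hklb : 512 * (m : ℝ) ^ 4 * Real.log n < k := by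
    have := Nat.lt_floor_add_one (512 * (m : ℝ) ^ 4 * Real.log n + 1)
    linarith
  have hk0 : (0 : ℝ) < k := lt_trans (by positivity) hklb
  have hkε : 8 * Real.log n ≤ k * (1 / (8 * (m : ℝ) ^ 2)) ^ 2 := by
    rw [div_pow, one_pow, mul_one_div, le_div_iff₀ (by positivity)]
    calc _ = 512 * (m : ℝ) ^ 4 * Real.log n := by ring
      _ ≤ k := hklb.le
  have hε1 : 1 / (8 * (m : ℝ) ^ 2) ≤ 1 / 8 := by
    have : (1 : ℝ) ≤ (m : ℝ) ^ 2 := one_le_pow₀ hm'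
    gcongr
    linarith
  obtain ⟨w, hw⟩ := exists_gramError_le hn (by positivity) hε1 hkε
    (by nlinarith) S hcard.le hnorm
  refine ⟨k, Matrix.of fun i j => if w i j then 1 / Real.sqrt k else -(1 / Real.sqrt k),
    Nat.floor_le (by positivity), fun i j => ?_, fun x hx y hy => ?_⟩
  · by_cases h : w i j <;> simp [h]
  · rw [signMatrix_mulVec_dotProduct_sub (by exact_mod_cast hk0), abs_div, Nat.abs_cast,
      div_le_iff₀ hk0, mul_comm]
    exact hw x hx y hy
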